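/- For every k ≥ 3, the Gallai-Ramsey number gr_k(K_3 ; S_8^2) equals 14·5^{(k-2)/2} + (1/2)·5^{(k-4)/2} + 1/2 if k is even, and equals 7·5^{(k-1)/2} + (1/4)·5^{(k-3)/2} + 3/4 if k is odd. -/

import Mathlib

/-- `SGraph t r` is the graph `S_t^r`: a star `K_{1,t-1}` with center `0`
together with `r` independent edges `(1,2), (3,4), …, (2r-1,2r)` among the leaves. -/
def SGraph (t r : ℕ) : SimpleGraph (Fin t) :=
  SimpleGraph.fromRel fun a b =>
    a.val = 0 ∨ (b.val = a.val + 1 ∧ a.val % 2 = 1 ∧ b.val ≤ 2 * r)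

/-- A monochromatic copy of `H` in the edge-coloring `c` of the complete graph on `V`. -/
def HasMonoCopy {α V C : Type*} (H : SimpleGraph α) (c : Sym2 V → C) : Prop :=
  ∃ (f : α ↪ V) (col : C), ∀ a b : α, H.Adj a b → c s(f a, f b) = col

/-- A copy of `H` in the edge-coloring `c` all of whose edges get color `col`. -/
def HasMonoCopyCol {α V C : Type*} (H : SimpleGraph α) (c : Sym2 V → C) (col : C) : Prop :=
  ∃ f : α ↪ V, ∀ a b : α, H.Adj a b → c s(f a, f b) = col

/-- A rainbow triangle in the edge-coloring `c` of the complete graph on `V`. -/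
def HasRainbowTriangle {V C : Type*} (c : Sym2 V → C) : Prop :=
  ∃ x y z : V,
    c s(x, y) ≠ c s(y, z) ∧ c s(y, z) ≠ c s(x, z) ∧ c s(x, y) ≠ c s(x, z)

section GallaiPartition

/-- The graph on `S` formed by the edges of color `α`. -/
def colorGraph {V C : Type*} (c : Sym2 V → C) (α : C) (S : Finset V) : SimpleGraph V where
  Adj a b := a ∈ S ∧ b ∈ S ∧ a ≠ b ∧ c s(a, b) = α
  symm := ⟨fun a b h => ⟨h.2.1, h.1, h.2.2.1.symm, by rw [Sym2.eq_swap]; exact h.2.2.2⟩⟩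
  loopless := ⟨fun a h => h.2.2.1 rfl⟩

/-- The color `α` occurs on some edge inside `S`. -/
def UsedColor {V C : Type*} (c : Sym2 V → C) (α : C) (S : Finset V) : Prop :=
  ∃ a b, (colorGraph c α S).Adj a b

/-- The color graph of `α` on `S` is connected. -/
def ColorConnected {V C : Type*} (c : Sym2 V → C) (α : C) (S : Finset V) : Prop :=
  ∀ a ∈ S, ∀ b ∈ S, (colorGraph c α S).Reachable a b

theorem gallai_triangle {V C : Type*} {c : Sym2 V → C} (hc : ¬ HasRainbowTriangle c) (x y z : V) :
    c s(x, y) = c s(y, z) ∨ c s(y, z) = c s(x, z) ∨ c s(x, y) = c s(x, z) := by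
  by_contra! h
  exact hc ⟨x, y, z, h⟩

theorem reachable_closed {V : Type*} {G : SimpleGraph V} {P : V → Prop} {a b : V}
    (h : G.Reachable a b) (ha : P a) (hP : ∀ x y, P x → G.Adj x y → P y) : P b := by
  obtain ⟨w⟩ := h
  induction w with
  | nil => exact ha
  | cons hadj _ ih => exact ih (hP _ _ ha hadj)

theorem reachable_mem {V C : Type*} {c : Sym2 V → C} {α : C} {S : Finset V} {a b : V}
    (h : (colorGraph c α S).Reachable a b) (ha : a ∈ S) : b ∈ S :=
  reachable_closed h ha fun _ _ _ h => h.2.1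

/-- Vertices outside a component of a color see the whole component in one color. -/
theorem component_homogeneous {V C : Type*} {c : Sym2 V → C} (hc : ¬ HasRainbowTriangle c)
    {α : C} {S : Finset V} {a a' b : V} (hb : b ∈ S)
    (h : (colorGraph c α S).Reachable a a') (hab : ¬ (colorGraph c α S).Reachable a b) :
    c s(a, b) = c s(a', b) := by
  have := reachable_closed (P := fun x => (colorGraph c α S).Reachable a x ∧ c s(a, b) = c s(x, b))
    h ⟨SimpleGraph.Reachable.refl a, rfl⟩ ?_
  · exact this.2
  · rintro x y ⟨hx, hxb⟩ hxy
    have hy := hx.trans hxy.reachable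
    refine ⟨hy, hxb.trans ?_⟩
    have key : ∀ z, (colorGraph c α S).Reachable a z → z ∈ S → c s(z, b) ≠ α := by
      intro z hz hzS hzb
      apply hab
      by_cases hzb' : z = b
      · rwa [← hzb']
      · exact hz.trans (SimpleGraph.Adj.reachable ⟨hzS, hb, hzb', hzb⟩)
    have h1 := key x hx hxy.1
    have h2 := key y hy hxy.2.1
    have h3 : c s(x, y) = α := hxy.2.2.2
    rcases gallai_triangle hc x y b with h | h | h
    · exact absurd (h.symm.trans h3) h2
    · exact h.symm
    · exact absurd (h.symm.trans h3) h1

theorem ColorConnected.exists_adj {V C : Type*} {c : Sym2 V → C} {α : C} {S : Finset V}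
    (h : ColorConnected c α S) {x y : V} (hx : x ∈ S) (hy : y ∈ S) (hxy : x ≠ y) :
    ∃ z, (colorGraph c α S).Adj x z := by
  by_contra! hcon
  have := reachable_closed (P := fun z => z = x) (h x hx y hy) rfl
    (fun a b ha hab => absurd hab (by rw [ha]; exact hcon b))
  exact hxy this.symm

open scoped Classical in
/-- In a coloring without rainbow triangles in which every used color is connected,
at most two colors are used. -/
theorem not_three_connected_colors {V C : Type*} {c : Sym2 V → C} (hc : ¬ HasRainbowTriangle c)
    (n : ℕ) : ∀ S : Finset V, S.card = n → (∀ α, UsedColor c α S → ColorConnected c α S) →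
    ∀ f : Fin 3 → C, Function.Injective f → ¬ ∀ i, UsedColor c (f i) S := by
  induction n with
  | zero =>
    intro S hS _ f _ hu
    obtain ⟨a, b, hab⟩ := hu 0
    rw [Finset.card_eq_zero] at hS
    subst hS
    exact absurd hab.1 (Finset.notMem_empty a)
  | succ n ih =>
    intro S hS hconn f hf hu
    obtain ⟨x, x₁, hxx₁⟩ := hu 0
    have hxS : x ∈ S := hxx₁.1
    have hnbr : ∀ i, ∃ z, (colorGraph c (f i) S).Adj x z := fun i =>
      (hconn _ (hu i)).exists_adj hxS hxx₁.2.1 hxx₁.2.2.1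
    have hmono : ∀ {α a b}, (colorGraph c α (S.erase x)).Adj a b → (colorGraph c α S).Adj a b :=
      fun h => ⟨Finset.mem_of_mem_erase h.1, Finset.mem_of_mem_erase h.2.1, h.2.2⟩
    by_cases hall : ∀ i, UsedColor c (f i) (S.erase x)
    · have hex : ∃ β, UsedColor c β (S.erase x) ∧ ¬ ColorConnected c β (S.erase x) := by
        by_contra! h
        exact ih (S.erase x) (by rw [Finset.card_erase_of_mem hxS]; omega) h f hf hall
      obtain ⟨β, hβ, hβn⟩ := hex
      have hβS : ColorConnected c β S := by
        obtain ⟨a, b, hab⟩ := hβ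
        exact hconn β ⟨a, b, hmono hab⟩
      have hinto : ∀ u ∈ S.erase x, ∃ y, (colorGraph c β (S.erase x)).Reachable u y ∧
          c s(x, y) = β := by
        intro u hu
        by_contra! hcon
        have := reachable_closed
          (P := fun z => z ≠ x ∧ (colorGraph c β (S.erase x)).Reachable u z)
          (hβS u (Finset.mem_of_mem_erase hu) x hxS)
          ⟨(Finset.mem_erase.1 hu).1, SimpleGraph.Reachable.refl u⟩ ?_
        · exact this.1 rfl
        · rintro a b ⟨hax, ha⟩ hab
          have hbx : b ≠ x := by
            rintro rfl
            exact hcon a ha (by rw [Sym2.eq_swap]; exact hab.2.2.2)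
          exact ⟨hbx, ha.trans (SimpleGraph.Adj.reachable
            ⟨Finset.mem_erase.2 ⟨hax, hab.1⟩, Finset.mem_erase.2 ⟨hbx, hab.2.1⟩, hab.2.2⟩)⟩
      have hcross : ∀ γ, γ ≠ β → ∀ y ∈ S.erase x, c s(x, y) = γ → ∀ z ∈ S.erase x,
          ¬ (colorGraph c β (S.erase x)).Reachable y z → c s(y, z) = γ := by
        intro γ hγ y hy hxy z hz hyz
        obtain ⟨z', hzz', hxz'⟩ := hinto z hz
        have hz'S := reachable_mem hzz' hz
        have hyz' : ¬ (colorGraph c β (S.erase x)).Reachable y z' :=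
          fun h => hyz (h.trans hzz'.symm)
        have h1 : c s(z', y) = c s(z, y) :=
          component_homogeneous hc hy hzz'.symm (fun h => hyz' h.symm)
        have h2 : c s(y, z') ≠ β := by
          intro h
          apply hyz'
          apply SimpleGraph.Adj.reachable
          refine ⟨hy, hz'S, ?_, h⟩
          rintro rfl
          exact hyz' (SimpleGraph.Reachable.refl _)
        have h3 : c s(y, z) = c s(y, z') := by
          rw [Sym2.eq_swap, ← h1, Sym2.eq_swap]
        rw [h3]
        rcases gallai_triangle hc x y z' with h | h | h
        · exact h.symm.trans hxy
        · exact absurd (h.trans hxz') h2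
        · exact absurd (hxy.symm.trans (h.trans hxz')) hγ
      have htwo : ∃ i j, i ≠ j ∧ f i ≠ β ∧ f j ≠ β := by
        by_cases h0 : f 0 = β
        · exact ⟨1, 2, by decide, fun h => absurd (hf (h.trans h0.symm)) (by decide),
            fun h => absurd (hf (h.trans h0.symm)) (by decide)⟩
        · by_cases h1 : f 1 = β
          · exact ⟨0, 2, by decide, h0, fun h => absurd (hf (h.trans h1.symm)) (by decide)⟩
          · exact ⟨0, 1, by decide, h0, h1⟩
      obtain ⟨i, j, hij, hi, hj⟩ := htwo
      obtain ⟨y₁, hy₁⟩ := hnbr i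
      obtain ⟨y₂, hy₂⟩ := hnbr j
      have hy₁S : y₁ ∈ S.erase x := Finset.mem_erase.2 ⟨hy₁.2.2.1.symm, hy₁.2.1⟩
      have hy₂S : y₂ ∈ S.erase x := Finset.mem_erase.2 ⟨hy₂.2.2.1.symm, hy₂.2.1⟩
      apply hij
      apply hf
      by_cases hr : (colorGraph c β (S.erase x)).Reachable y₁ y₂
      · have hz : ∃ z ∈ S.erase x, ¬ (colorGraph c β (S.erase x)).Reachable y₁ z := by
          by_contra! h
          exact hβn fun a ha b hb => (h a ha).symm.trans (h b hb)
        obtain ⟨z, hz, hyz⟩ := hz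
        rw [← hcross _ hi y₁ hy₁S hy₁.2.2.2 z hz hyz,
          ← hcross _ hj y₂ hy₂S hy₂.2.2.2 z hz (fun h => hyz (hr.trans h))]
        exact component_homogeneous hc hz hr hyz
      · rw [← hcross _ hi y₁ hy₁S hy₁.2.2.2 y₂ hy₂S hr,
          ← hcross _ hj y₂ hy₂S hy₂.2.2.2 y₁ hy₁S (fun h => hr h.symm), Sym2.eq_swap]
    · push Not at hall
      obtain ⟨i, hi⟩ := hall
      have honly : ∀ y ∈ S, y ≠ x → c s(x, y) = f i := by
        intro y hy hyx
        obtain ⟨z, hz⟩ := (hconn _ (hu i)).exists_adj hy hxS hyx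
        by_cases hzx : z = x
        · subst hzx
          rw [Sym2.eq_swap]
          exact hz.2.2.2
        · exact absurd ⟨y, z, Finset.mem_erase.2 ⟨hyx, hy⟩, Finset.mem_erase.2 ⟨hzx, hz.2.1⟩,
            hz.2.2⟩ hi
      obtain ⟨j, hj⟩ : ∃ j, j ≠ i := exists_ne i
      obtain ⟨z, hz⟩ := hnbr j
      exact hj (hf (hz.2.2.2.symm.trans (honly z hz.2.1 hz.2.2.1.symm)))

end GallaiPartition

section HomogeneousPartition

open scoped Classical

/-- `p : V → Fin q` labels a partition of `W` into nonempty parts with representatives `r`,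
the color between two parts being constant. -/
structure IsHomogeneousPartition {V C : Type*} (c : Sym2 V → C) (W : Finset V) (q : ℕ)
    (p : V → Fin q) (r : Fin q → V) : Prop where
  rep_mem : ∀ i, r i ∈ W
  rep_label : ∀ i, p (r i) = i
  color_eq : ∀ x ∈ W, ∀ y ∈ W, p x ≠ p y → c s(x, y) = c s(r (p x), r (p y))

theorem exists_trivial_partition {V C : Type*} (c : Sym2 V → C) (W : Finset V)
    (hW : 2 ≤ W.card) : ∃ p r, IsHomogeneousPartition c W W.card p r := by
  have h0 : 0 < W.card := by omega
  refine ⟨fun x => if h : x ∈ W then W.equivFin ⟨x, h⟩ else ⟨0, h0⟩,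
    fun i => (W.equivFin.symm i : W), fun i => (W.equivFin.symm i).2, fun i => ?_, ?_⟩
  · simp
  · intro x hx y hy _
    simp [hx, hy]

theorem IsHomogeneousPartition.coarsen {V C : Type*} {c : Sym2 V → C} {W : Finset V} {q : ℕ}
    {p : V → Fin q} {r : Fin q → V} (h : IsHomogeneousPartition c W q p r)
    {K : Type*} [Fintype K] (g : Fin q → K) (hg : Function.Surjective g)
    (hgc : ∀ i i' j j', g i = g i' → g j = g j' → g i ≠ g j → c s(r i, r j) = c s(r i', r j')) :
    ∃ p' r', IsHomogeneousPartition c W (Fintype.card K) p' r' := by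
  let e := Fintype.equivFin K
  obtain ⟨g', hg'⟩ := hg.hasRightInverse
  refine ⟨fun x => e (g (p x)), fun i => r (g' (e.symm i)), fun i => h.rep_mem _, fun i => ?_, ?_⟩
  · simp [h.rep_label, hg' _]
  · intro x hx y hy hxy
    have hne : g (p x) ≠ g (p y) := fun h => hxy (congrArg e h)
    rw [h.color_eq x hx y hy fun h => hne (congrArg g h)]
    apply hgc _ _ _ _ _ _ hne
    · simp [hg' _]
    · simp [hg' _]

theorem exists_gallai_partition {V C : Type*} {c : Sym2 V → C} (hc : ¬ HasRainbowTriangle c)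
    (W : Finset V) (hW : 2 ≤ W.card) :
    (∃ α, ∃ P Q : Finset V, P.Nonempty ∧ Q.Nonempty ∧ Disjoint P Q ∧ P ∪ Q = W ∧
      ∀ x ∈ P, ∀ y ∈ Q, c s(x, y) = α) ∨
    (∃ q, 3 ≤ q ∧ ∃ (p : V → Fin q) (r : Fin q → V), IsHomogeneousPartition c W q p r ∧
      ∃ α β, α ≠ β ∧ (∀ i j, i ≠ j → c s(r i, r j) = α ∨ c s(r i, r j) = β) ∧
        ∀ i, (∃ j, i ≠ j ∧ c s(r i, r j) = α) ∧ (∃ j, i ≠ j ∧ c s(r i, r j) = β)) := by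
  have hex : ∃ q, 2 ≤ q ∧ ∃ p r, IsHomogeneousPartition c W q p r :=
    ⟨W.card, hW, exists_trivial_partition c W hW⟩
  obtain ⟨q, ⟨hq2, p, r, hpr⟩, hmin⟩ :
      ∃ q, (2 ≤ q ∧ ∃ p r, IsHomogeneousPartition c W q p r) ∧
        ∀ m < q, ¬ (2 ≤ m ∧ ∃ p r, IsHomogeneousPartition c W m p r) :=
    ⟨Nat.find hex, Nat.find_spec hex, fun m => Nat.find_min hex⟩
  have hsplit : ∀ (i₀ : Fin q) (α : C), (∀ j, i₀ ≠ j → c s(r i₀, r j) = α) →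
      ∃ α, ∃ P Q : Finset V, P.Nonempty ∧ Q.Nonempty ∧ Disjoint P Q ∧ P ∪ Q = W ∧
      ∀ x ∈ P, ∀ y ∈ Q, c s(x, y) = α := by
    intro i₀ α h
    have : Nontrivial (Fin q) := Fin.nontrivial_iff_two_le.2 hq2
    obtain ⟨j, hj⟩ := exists_ne i₀
    refine ⟨α, W.filter (fun x => p x = i₀), W.filter (fun x => ¬ p x = i₀), ⟨r i₀, ?_⟩,
      ⟨r j, ?_⟩, Finset.disjoint_filter_filter_not _ _ _, Finset.filter_union_filter_not_eq _ _, ?_⟩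
    · simp [hpr.rep_mem, hpr.rep_label]
    · simp [hpr.rep_mem, hpr.rep_label, hj]
    · intro x hx y hy
      rw [Finset.mem_filter] at hx hy
      have hne : p x ≠ p y := fun h => hy.2 (h.symm.trans hx.2)
      rw [hpr.color_eq x hx.1 y hy.1 hne, hx.2]
      exact h _ fun h => hy.2 h.symm
  let d : Sym2 (Fin q) → C := fun s => c (s.map r)
  have hd : ¬ HasRainbowTriangle d := by
    rintro ⟨x, y, z, h⟩
    exact hc ⟨r x, r y, r z, h⟩
  have hconn : ∀ α, UsedColor d α Finset.univ → ColorConnected d α Finset.univ := by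
    intro α hα
    by_contra hnc
    obtain ⟨a, b, hab⟩ := hα
    unfold ColorConnected at hnc
    push Not at hnc
    obtain ⟨u, _, v, _, huv⟩ := hnc
    let G := colorGraph d α Finset.univ
    obtain ⟨p', r', hp'⟩ := hpr.coarsen (K := G.ConnectedComponent) G.connectedComponentMk
      Quot.mk_surjective (by
        intro i i' j j' hi hj hij
        rw [SimpleGraph.ConnectedComponent.eq] at hi hj
        have hij' : ¬ G.Reachable i j := fun h => hij (SimpleGraph.ConnectedComponent.eq.2 h)
        have h1 : d s(i, j) = d s(i', j) :=
          component_homogeneous hd (Finset.mem_univ _) hi hij'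
        have h2 : d s(j, i') = d s(j', i') :=
          component_homogeneous hd (Finset.mem_univ _) hj
            (fun h => hij' (hi.trans h.symm))
        rw [Sym2.eq_swap, Sym2.eq_swap (a := j')] at h2
        exact h1.trans h2)
    refine hmin (Fintype.card G.ConnectedComponent) ?_ ⟨?_, p', r', hp'⟩
    · have h : Fintype.card G.ConnectedComponent < Fintype.card (Fin q) := by
        apply Fintype.card_lt_of_surjective_not_injective G.connectedComponentMk
          Quot.mk_surjective
        intro hinj
        exact hab.2.2.1 (hinj (SimpleGraph.ConnectedComponent.eq.2 hab.reachable))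
      simpa using h
    · have : Nontrivial G.ConnectedComponent :=
        ⟨G.connectedComponentMk u, G.connectedComponentMk v,
          fun h => huv (SimpleGraph.ConnectedComponent.eq.1 h)⟩
      exact Fintype.one_lt_card
  have hused : ∀ i j : Fin q, i ≠ j → UsedColor d (d s(i, j)) Finset.univ :=
    fun i j hij => ⟨i, j, Finset.mem_univ _, Finset.mem_univ _, hij, rfl⟩
  let i0 : Fin q := ⟨0, by omega⟩
  let i1 : Fin q := ⟨1, by omega⟩
  have h01 : i0 ≠ i1 := by simp [i0, i1]
  by_cases hone : ∀ j, i0 ≠ j → d s(i0, j) = d s(i0, i1)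
  · exact Or.inl (hsplit i0 _ hone)
  · push Not at hone
    obtain ⟨i2, h02, hne⟩ := hone
    right
    refine ⟨q, ?_, p, r, hpr, d s(i0, i1), d s(i0, i2), hne.symm, ?_, ?_⟩
    · by_contra hlt
      have hq : q = 2 := by omega
      have h2 := i2.2
      have : i2 = i1 := by
        apply Fin.ext
        have : (i2 : ℕ) ≠ 0 := fun h => h02 (Fin.ext h.symm)
        simp only [i1]
        omega
      exact hne (by rw [this])
    · intro i j hij
      by_contra! hcon
      refine not_three_connected_colors hd _ Finset.univ rfl hconn
        ![d s(i0, i1), d s(i0, i2), d s(i, j)] ?_ ?_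
      · intro a b hab
        have e1 := hcon.1
        have e2 := hcon.2
        change d s(i, j) ≠ d s(i0, i1) at e1
        change d s(i, j) ≠ d s(i0, i2) at e2
        fin_cases a <;> fin_cases b <;> simp_all
      · intro a
        fin_cases a
        · exact hused i0 i1 h01
        · exact hused i0 i2 h02
        · exact hused i j hij
    · have : Nontrivial (Fin q) := Fin.nontrivial_iff_two_le.2 hq2
      have hadj : ∀ α, UsedColor d α Finset.univ → ∀ i, ∃ j, i ≠ j ∧ c s(r i, r j) = α := by
        intro α hα i
        obtain ⟨j, hj⟩ := exists_ne i
        obtain ⟨z, hz⟩ := (hconn α hα).exists_adj (Finset.mem_univ i) (Finset.mem_univ j) hj.symm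
        exact ⟨z, hz.2.2.1, hz.2.2.2⟩
      exact fun i => ⟨hadj _ (hused i0 i1 h01) i, hadj _ (hused i0 i2 h02) i⟩

end HomogeneousPartition

section DeadEdges

open scoped Classical

/-- Any two edges of color `α` inside `S` share a vertex. -/
def Intersecting {V C : Type*} (c : Sym2 V → C) (α : C) (S : Finset V) : Prop :=
  ∀ a ∈ S, ∀ b ∈ S, ∀ a' ∈ S, ∀ b' ∈ S, a ≠ b → a' ≠ b' → c s(a, b) = α → c s(a', b') = α →
    a = a' ∨ a = b' ∨ b = a' ∨ b = b'

/-- No two disjoint edges of color `α` are seen in color `α` by a vertex having at least seven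
neighbors in that color. -/
def StarFree {V C : Type*} (c : Sym2 V → C) : Prop :=
  ∀ v α (S : Finset V), 7 ≤ S.card → (∀ x ∈ S, x ≠ v ∧ c s(v, x) = α) → Intersecting c α S

theorem starFree_of_not_hasMonoCopy {V C : Type*} {c : Sym2 V → C}
    (h : ¬ HasMonoCopy (SGraph 8 2) c) : StarFree c := by
  intro v α S hS hv a ha b hb a' ha' b' hb' hab hab' h1 h2
  by_contra! hne
  obtain ⟨haa, hab2, hba, hbb⟩ := hne
  have hcard : 3 ≤ (S \ {a, b, a', b'}).card := by
    have := Finset.le_card_sdiff ({a, b, a', b'} : Finset V) S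
    have h4 : ({a, b, a', b'} : Finset V).card ≤ 4 := Finset.card_le_four
    omega
  obtain ⟨T, hT, hT3⟩ := Finset.exists_subset_card_eq hcard
  obtain ⟨x, y, z, hxy, hxz, hyz, rfl⟩ := Finset.card_eq_three.1 hT3
  have hx := hT (show x ∈ ({x, y, z} : Finset V) by simp)
  have hy := hT (show y ∈ ({x, y, z} : Finset V) by simp)
  have hz := hT (show z ∈ ({x, y, z} : Finset V) by simp)
  simp only [Finset.mem_sdiff, Finset.mem_insert, Finset.mem_singleton, not_or] at hx hy hz
  have va := hv a ha
  have vb := hv b hb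
  have va' := hv a' ha'
  have vb' := hv b' hb'
  have vx := hv x hx.1
  have vy := hv y hy.1
  have vz := hv z hz.1
  clear hT hT3 hcard
  apply h
  refine ⟨⟨![v, a, b, a', b', x, y, z], ?_⟩, α, ?_⟩
  · intro i j hij
    clear hv h1 h2
    fin_cases i <;> fin_cases j <;> simp_all
  · have w1 := va.2
    have w2 := vb.2
    have w3 := va'.2
    have w4 := vb'.2
    have w5 := vx.2
    have w6 := vy.2
    have w7 := vz.2
    have w (p q : V) (hpq : c s(p, q) = α) : c s(q, p) = α := by rwa [Sym2.eq_swap]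
    intro i j hij
    fin_cases i <;> fin_cases j <;> first
      | (exfalso; revert hij; simp [SGraph]; done)
      | exact h1 | exact h2 | exact w1 | exact w2 | exact w3 | exact w4 | exact w5 | exact w6
      | exact w7 | exact w _ _ h1 | exact w _ _ h2 | exact w _ _ w1 | exact w _ _ w2
      | exact w _ _ w3 | exact w _ _ w4 | exact w _ _ w5 | exact w _ _ w6 | exact w _ _ w7

theorem Intersecting.mono {V C : Type*} {c : Sym2 V → C} {α : C} {S T : Finset V}
    (h : Intersecting c α S) (hT : T ⊆ S) : Intersecting c α T :=
  fun a ha b hb a' ha' b' hb' => h a (hT ha) b (hT hb) a' (hT ha') b' (hT hb')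

/-- Pairwise intersecting edges form a star or lie in a triangle. -/
theorem Intersecting.star_or_triangle {V C : Type*} {c : Sym2 V → C} {α : C} {S : Finset V}
    (h : Intersecting c α S) (hS : S.Nonempty) :
    (∃ z ∈ S, ∀ a ∈ S, ∀ b ∈ S, a ≠ b → c s(a, b) = α → a = z ∨ b = z) ∨
    (∃ T ⊆ S, T.card = 3 ∧ ∀ a ∈ S, ∀ b ∈ S, a ≠ b → c s(a, b) = α → a ∈ T ∧ b ∈ T) := by
  by_cases hex : ∃ a ∈ S, ∃ b ∈ S, a ≠ b ∧ c s(a, b) = α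
  · obtain ⟨a, ha, b, hb, hab, h1⟩ := hex
    have hstep : ∀ a b, a ∈ S → b ∈ S → a ≠ b → c s(a, b) = α →
        (∀ x ∈ S, ∀ y ∈ S, x ≠ y → c s(x, y) = α → x = a ∨ y = a) ∨
        ∃ d ∈ S, d ≠ a ∧ d ≠ b ∧ c s(b, d) = α := by
      intro a b ha hb hab h1
      by_cases hs : ∀ x ∈ S, ∀ y ∈ S, x ≠ y → c s(x, y) = α → x = a ∨ y = a
      · exact Or.inl hs
      · push Not at hs
        obtain ⟨x, hx, y, hy, hxy, h2, hxa, hya⟩ := hs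
        rcases h a ha b hb x hx y hy hab hxy h1 h2 with e | e | e | e
        · exact absurd e.symm hxa
        · exact absurd e.symm hya
        · subst e
          exact Or.inr ⟨y, hy, hya, hxy.symm, h2⟩
        · subst e
          exact Or.inr ⟨x, hx, hxa, hxy, by rwa [Sym2.eq_swap]⟩
    rcases hstep a b ha hb hab h1 with hs | ⟨d, hd, hda, hdb, hbd⟩
    · exact Or.inl ⟨a, ha, hs⟩
    rcases hstep b a hb ha hab.symm (by rwa [Sym2.eq_swap]) with hs | ⟨d', hd', hdb', hda', had⟩
    · exact Or.inl ⟨b, hb, hs⟩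
    have hdd : d = d' := by
      rcases h b hb d hd a ha d' hd' hdb.symm hda'.symm hbd had with e | e | e | e
      · exact absurd e.symm hab
      · exact absurd e.symm hdb'
      · exact absurd e hda
      · exact e
    subst hdd
    right
    refine ⟨{a, b, d}, ?_, ?_, ?_⟩
    · intro x hx
      simp only [Finset.mem_insert, Finset.mem_singleton] at hx
      rcases hx with rfl | rfl | rfl <;> assumption
    · exact Finset.card_eq_three.2 ⟨a, b, d, hab, hda.symm, hdb.symm, rfl⟩
    · intro x hx y hy hxy h2
      have e1 := h a ha b hb x hx y hy hab hxy h1 h2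
      have e2 := h b hb d hd x hx y hy hdb.symm hxy hbd h2
      have e3 := h a ha d hd x hx y hy hda.symm hxy had h2
      simp only [Finset.mem_insert, Finset.mem_singleton]
      grind
  · push Not at hex
    obtain ⟨z, hz⟩ := hS
    exact Or.inl ⟨z, hz, fun a ha b hb hab h1 => absurd h1 (hex a ha b hb hab)⟩

theorem Intersecting.exists_cover {V C : Type*} {c : Sym2 V → C} {α : C} {S : Finset V}
    (h : Intersecting c α S) : ∃ T ⊆ S, T.card ≤ 2 ∧
      ∀ a ∈ S \ T, ∀ b ∈ S \ T, a ≠ b → c s(a, b) ≠ α := by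
  rcases S.eq_empty_or_nonempty with rfl | hS
  · exact ⟨∅, by simp⟩
  rcases h.star_or_triangle hS with ⟨z, hz, hs⟩ | ⟨T, hT, hT3, hs⟩
  · refine ⟨{z}, by simpa using hz, by simp, fun a ha b hb hab h1 => ?_⟩
    simp only [Finset.mem_sdiff, Finset.mem_singleton] at ha hb
    rcases hs a ha.1 b hb.1 hab h1 with e | e
    · exact ha.2 e
    · exact hb.2 e
  · obtain ⟨x, y, z, hxy, hxz, hyz, rfl⟩ := Finset.card_eq_three.1 hT3
    refine ⟨{x, y}, fun w hw => hT ?_, Finset.card_le_two, fun a ha b hb hab h1 => ?_⟩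
    · simp only [Finset.mem_insert, Finset.mem_singleton] at hw ⊢
      tauto
    · simp only [Finset.mem_sdiff, Finset.mem_insert, Finset.mem_singleton, not_or] at ha hb
      have := hs a ha.1 b hb.1 hab h1
      simp only [Finset.mem_insert, Finset.mem_singleton] at this
      grind

/-- The edges inside `S` satisfying `K`. -/
noncomputable def insideEdges {V : Type*} (K : Sym2 V → Prop) (S : Finset V) : Finset (Sym2 V) :=
  S.sym2.filter fun s => ¬ s.IsDiag ∧ K s

theorem mk_mem_insideEdges {V : Type*} {K : Sym2 V → Prop} {S : Finset V} {x y : V} :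
    s(x, y) ∈ insideEdges K S ↔ x ∈ S ∧ y ∈ S ∧ x ≠ y ∧ K s(x, y) := by
  simp [insideEdges, and_assoc]

theorem mem_insideEdges {V : Type*} {K : Sym2 V → Prop} {S : Finset V} {s : Sym2 V} :
    s ∈ insideEdges K S ↔ s ∈ S.sym2 ∧ ¬ s.IsDiag ∧ K s := by
  simp [insideEdges]

theorem insideEdges_mono {V : Type*} {K : Sym2 V → Prop} {S T : Finset V} (h : S ⊆ T) :
    insideEdges K S ⊆ insideEdges K T := by
  intro s
  induction s with
  | _ x y =>
    rw [mk_mem_insideEdges, mk_mem_insideEdges]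
    exact fun hs => ⟨h hs.1, h hs.2.1, hs.2.2⟩

theorem sum_card_insideEdges_le {V ι : Type*} {K : Sym2 V → Prop} {W : Finset V} (I : Finset ι)
    {P : ι → Finset V} (hP : ∀ i ∈ I, P i ⊆ W)
    (hd : ∀ i ∈ I, ∀ j ∈ I, i ≠ j → Disjoint (P i) (P j)) :
    ∑ i ∈ I, (insideEdges K (P i)).card ≤ (insideEdges K W).card := by
  rw [← Finset.card_biUnion]
  · apply Finset.card_le_card
    intro s hs
    obtain ⟨i, hi, his⟩ := Finset.mem_biUnion.1 hs
    exact insideEdges_mono (hP i hi) his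
  · intro i hi j hj hij
    rw [Function.onFun, Finset.disjoint_left]
    intro s
    induction s with
    | _ x y =>
      rw [mk_mem_insideEdges, mk_mem_insideEdges]
      exact fun h1 h2 => Finset.disjoint_left.1 (hd i hi j hj hij) h1.1 h2.1

theorem card_insideEdges_add_le {V : Type*} {K : Sym2 V → Prop} {W P Q : Finset V}
    (hP : P ⊆ W) (hQ : Q ⊆ W) (hd : Disjoint P Q) :
    (insideEdges K P).card + (insideEdges K Q).card ≤ (insideEdges K W).card := by
  have := sum_card_insideEdges_le (K := K) (W := W) (Finset.univ : Finset Bool)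
    (P := fun b => if b then P else Q) (by simp [hP, hQ]) (by simp [hd, hd.symm])
  simpa using this

/-- The edges of color `α` inside `S`. -/
noncomputable def colorEdges {V C : Type*} (c : Sym2 V → C) (α : C) (S : Finset V) :
    Finset (Sym2 V) := insideEdges (fun s => c s = α) S

/-- The edges inside `S` whose color is not in the set `L` of live colors. -/
noncomputable def deadEdges {V C : Type*} (c : Sym2 V → C) (L : Finset C) (S : Finset V) :
    Finset (Sym2 V) := insideEdges (fun s => c s ∉ L) S

/-- No dead color occurs on two edges inside `S`. -/
def DeadUniq {V C : Type*} (c : Sym2 V → C) (L : Finset C) (S : Finset V) : Prop :=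
  ∀ s ∈ deadEdges c L S, ∀ t ∈ deadEdges c L S, c s = c t → s = t

theorem mk_mem_deadEdges {V C : Type*} {c : Sym2 V → C} {L : Finset C} {S : Finset V} {x y : V} :
    s(x, y) ∈ deadEdges c L S ↔ x ∈ S ∧ y ∈ S ∧ x ≠ y ∧ c s(x, y) ∉ L := mk_mem_insideEdges

theorem deadEdges_mono {V C : Type*} (c : Sym2 V → C) (L : Finset C) {S T : Finset V}
    (h : S ⊆ T) : deadEdges c L S ⊆ deadEdges c L T := insideEdges_mono h

theorem mk_mem_colorEdges {V C : Type*} {c : Sym2 V → C} {α : C} {S : Finset V} {x y : V} :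
    s(x, y) ∈ colorEdges c α S ↔ x ∈ S ∧ y ∈ S ∧ x ≠ y ∧ c s(x, y) = α := mk_mem_insideEdges

theorem DeadUniq.mono {V C : Type*} {c : Sym2 V → C} {L : Finset C} {S T : Finset V}
    (h : DeadUniq c L S) (hT : T ⊆ S) : DeadUniq c L T :=
  fun s hs t ht => h s (insideEdges_mono hT hs) t (insideEdges_mono hT ht)

/-- The endpoints of a dead edge are twins. -/
theorem DeadUniq.twins {V C : Type*} {c : Sym2 V → C} {L : Finset C} {W : Finset V}
    (h : DeadUniq c L W) (hc : ¬ HasRainbowTriangle c) {x y z : V} (hx : x ∈ W) (hy : y ∈ W)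
    (hz : z ∈ W) (hxy : x ≠ y) (hzx : z ≠ x) (hzy : z ≠ y) (hd : c s(x, y) ∉ L) :
    c s(x, z) = c s(y, z) := by
  have hxyd := mk_mem_deadEdges.2 ⟨hx, hy, hxy, hd⟩
  rcases gallai_triangle hc x y z with e | e | e
  · have := h _ hxyd s(y, z) (mk_mem_deadEdges.2 ⟨hy, hz, hzy.symm, by rwa [← e]⟩) e
    simp at this
    grind
  · exact e.symm
  · have := h _ hxyd s(x, z) (mk_mem_deadEdges.2 ⟨hx, hz, hzx.symm, by rwa [← e]⟩) e
    simp at this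
    grind

/-- Dead edges form a matching. -/
theorem DeadUniq.matching {V C : Type*} {c : Sym2 V → C} {L : Finset C} {W : Finset V}
    (h : DeadUniq c L W) (hc : ¬ HasRainbowTriangle c) {x y z : V} (hx : x ∈ W) (hy : y ∈ W)
    (hz : z ∈ W) (hxy : x ≠ y) (hxz : x ≠ z) (hd : c s(x, y) ∉ L) (hd' : c s(x, z) ∉ L) :
    y = z := by
  by_contra hyz
  have e := h.twins hc hx hy hz hxy hxz.symm (Ne.symm hyz) hd
  have := h _ (mk_mem_deadEdges.2 ⟨hx, hz, hxz, hd'⟩) s(y, z)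
    (mk_mem_deadEdges.2 ⟨hy, hz, hyz, by rwa [← e]⟩) e
  simp at this
  grind

/-- A live color occurring at most once may be declared dead. -/
theorem DeadUniq.erase {V C : Type*} {c : Sym2 V → C} {L : Finset C} {S : Finset V}
    (h : DeadUniq c L S) (α : C) (hα : (colorEdges c α S).card ≤ 1) :
    DeadUniq c (L.erase α) S := by
  have key : ∀ s ∈ deadEdges c (L.erase α) S, s ∈ deadEdges c L S ∨ s ∈ colorEdges c α S := by
    intro s
    induction s with
    | _ x y =>
      rw [mk_mem_deadEdges, mk_mem_deadEdges, mk_mem_colorEdges, Finset.mem_erase]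
      tauto
  have hcol : ∀ s ∈ colorEdges c α S, c s = α := fun s hs => (mem_insideEdges.1 hs).2.2
  have hin : ∀ s ∈ deadEdges c (L.erase α) S, c s = α → s ∈ colorEdges c α S := fun s hs e =>
    mem_insideEdges.2 ⟨(mem_insideEdges.1 hs).1, (mem_insideEdges.1 hs).2.1, e⟩
  intro s hs t ht e
  rcases key s hs with h1 | h1
  · rcases key t ht with h2 | h2
    · exact h s h1 t h2 e
    · exact Finset.card_le_one.1 hα s (hin s hs (e.trans (hcol t h2))) t h2
  · exact Finset.card_le_one.1 hα s h1 t (hin t ht (e.symm.trans (hcol s h1)))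

theorem card_deadEdges_erase_le {V C : Type*} (c : Sym2 V → C) (L : Finset C) (S : Finset V)
    (α : C) : (deadEdges c (L.erase α) S).card ≤
      (deadEdges c L S).card + (colorEdges c α S).card := by
  refine (Finset.card_le_card fun s hs => ?_).trans (Finset.card_union_le _ _)
  induction s with
  | _ x y =>
    rw [mk_mem_deadEdges, Finset.mem_erase] at hs
    rw [Finset.mem_union, mk_mem_deadEdges, mk_mem_colorEdges]
    tauto

theorem card_colorEdges_le_one {V C : Type*} {c : Sym2 V → C} {α : C} {S : Finset V}
    (h : ∀ a ∈ S, ∀ b ∈ S, ∀ a' ∈ S, ∀ b' ∈ S, a ≠ b → a' ≠ b' → c s(a, b) = α →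
      c s(a', b') = α → s(a, b) = s(a', b')) : (colorEdges c α S).card ≤ 1 := by
  rw [Finset.card_le_one]
  intro s
  induction s with
  | _ a b =>
    intro hs t
    induction t with
    | _ a' b' =>
      intro ht
      rw [mk_mem_colorEdges] at hs ht
      exact h a hs.1 b hs.2.1 a' ht.1 b' ht.2.1 hs.2.2.1 ht.2.2.1 hs.2.2.2 ht.2.2.2

theorem card_colorEdges_eq_zero {V C : Type*} {c : Sym2 V → C} {α : C} {S : Finset V}
    (h : ∀ a ∈ S, ∀ b ∈ S, a ≠ b → c s(a, b) ≠ α) : (colorEdges c α S).card = 0 := by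
  rw [Finset.card_eq_zero, Finset.eq_empty_iff_forall_notMem]
  intro s
  induction s with
  | _ a b =>
    rw [mk_mem_colorEdges]
    exact fun hs => h a hs.1 b hs.2.1 hs.2.2.1 hs.2.2.2

/-- The vertices of `S` incident with a dead edge. -/
noncomputable def covered {V C : Type*} (c : Sym2 V → C) (L : Finset C) (S : Finset V) :
    Finset V := S.filter fun x => ∃ y ∈ S, x ≠ y ∧ c s(x, y) ∉ L

theorem card_covered_le {V C : Type*} (c : Sym2 V → C) (L : Finset C) (S : Finset V) :
    (covered c L S).card ≤ 2 * (deadEdges c L S).card := by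
  have h1 : covered c L S ⊆ (deadEdges c L S).biUnion fun s => s.toFinset := by
    intro x hx
    obtain ⟨hx, y, hy, hxy, hd⟩ := Finset.mem_filter.1 hx
    exact Finset.mem_biUnion.2 ⟨s(x, y), mk_mem_deadEdges.2 ⟨hx, hy, hxy, hd⟩, by simp⟩
  refine (Finset.card_le_card h1).trans ?_
  rw [mul_comm]
  refine Finset.card_biUnion_le_card_mul _ _ _ fun s _ => ?_
  rw [Sym2.card_toFinset]
  split <;> omega

theorem exists_undead {V C : Type*} {c : Sym2 V → C} {L : Finset C} {S Z : Finset V} (hZ : Z ⊆ S)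
    (h : (covered c L S).card < Z.card) : ∃ u ∈ Z, ∀ y ∈ S, u ≠ y → c s(u, y) ∈ L := by
  obtain ⟨u, hu, hn⟩ := Finset.exists_mem_notMem_of_card_lt_card h
  refine ⟨u, hu, fun y hy huy => ?_⟩
  by_contra hd
  exact hn (Finset.mem_filter.2 ⟨hZ hu, y, hy, huy, hd⟩)

/-- The neighbors of `x` in `W` in color `α`. -/
noncomputable def nb {V C : Type*} (c : Sym2 V → C) (α : C) (x : V) (W : Finset V) : Finset V :=
  W.filter fun y => y ≠ x ∧ c s(x, y) = α

theorem mem_nb {V C : Type*} {c : Sym2 V → C} {α : C} {x y : V} {W : Finset V} :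
    y ∈ nb c α x W ↔ y ∈ W ∧ y ≠ x ∧ c s(x, y) = α := Finset.mem_filter

theorem nb_subset {V C : Type*} (c : Sym2 V → C) (α : C) (x : V) (W : Finset V) :
    nb c α x W ⊆ W := Finset.filter_subset _ _

theorem StarFree.intersecting_nb {V C : Type*} {c : Sym2 V → C} (h : StarFree c) {α : C} {x : V}
    {W : Finset V} (hn : 7 ≤ (nb c α x W).card) : Intersecting c α (nb c α x W) :=
  h x α _ hn fun _ hy => (mem_nb.1 hy).2

/-- A set of four vertices whose inside edges are dead or of color `β` cannot lie in a `β`-star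
with seven leaves. -/
theorem StarFree.card_le_six {V C : Type*} {c : Sym2 V → C} (h : StarFree c)
    (hc : ¬ HasRainbowTriangle c) {L : Finset C} {W S R : Finset V} {w : V} {β : C}
    (hu : DeadUniq c L W) (hSW : S ⊆ W) (hSR : S ⊆ R) (hS : 4 ≤ S.card)
    (hpair : ∀ x ∈ S, ∀ y ∈ S, x ≠ y → c s(x, y) ∈ L → c s(x, y) = β)
    (hR : ∀ x ∈ R, x ≠ w ∧ c s(w, x) = β) : R.card ≤ 6 := by
  by_contra! hlt
  have hi := (h w β R hlt hR).mono hSR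
  obtain ⟨T, hT, hT4⟩ := Finset.exists_subset_card_eq hS
  obtain ⟨a, b, d, e, hab, had, hae, hbd, hbe, hde, rfl⟩ := Finset.card_eq_four.1 hT4
  have ha := hT (show a ∈ ({a, b, d, e} : Finset V) by simp)
  have hb := hT (show b ∈ ({a, b, d, e} : Finset V) by simp)
  have hd := hT (show d ∈ ({a, b, d, e} : Finset V) by simp)
  have he := hT (show e ∈ ({a, b, d, e} : Finset V) by simp)
  have key : ∀ x y z t, x ∈ S → y ∈ S → z ∈ S → t ∈ S → x ≠ y → z ≠ t → x ≠ z → x ≠ t → y ≠ z →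
      y ≠ t → c s(x, y) ∉ L ∨ c s(z, t) ∉ L := by
    intro x y z t hx hy hz ht hxy hzt h1 h2 h3 h4
    by_contra! hcon
    have := hi x hx y hy z hz t ht hxy hzt (hpair x hx y hy hxy hcon.1)
      (hpair z hz t ht hzt hcon.2)
    tauto
  have k1 := key a b d e ha hb hd he hab hde had hae hbd hbe
  have k2 := key a d b e ha hd hb he had hbe hab hae hbd.symm hde
  have m : ∀ x y z, x ∈ S → y ∈ S → z ∈ S → x ≠ y → x ≠ z → y ≠ z → c s(x, y) ∉ L →
      c s(x, z) ∈ L := by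
    intro x y z hx hy hz hxy hxz hyz h1
    by_contra h2
    exact hyz (hu.matching hc (hSW hx) (hSW hy) (hSW hz) hxy hxz h1 h2)
  rcases k1 with k1 | k1
  · have m1 := m a b d ha hb hd hab had hbd k1
    have m2 := m b a e hb ha he hab.symm hbe hae (by rwa [Sym2.eq_swap])
    tauto
  · have m1 := m d e a hd he ha hde had.symm hae.symm k1
    have m2 := m e d b he hd hb hde.symm hbe.symm hbd.symm (by rwa [Sym2.eq_swap])
    rw [Sym2.eq_swap] at m1 m2
    tauto

end DeadEdges

section FewColors

open scoped Classical

variable {V C : Type*} {c : Sym2 V → C}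

/-- The neighbors of `x` in `W` along dead edges. -/
noncomputable def deadNb (c : Sym2 V → C) (L : Finset C) (x : V) (W : Finset V) : Finset V :=
  W.filter fun y => y ≠ x ∧ c s(x, y) ∉ L

theorem nb_mono {α : C} {x : V} {S W : Finset V} (h : S ⊆ W) : nb c α x S ⊆ nb c α x W :=
  Finset.filter_subset_filter _ h

theorem DeadUniq.card_deadNb_le_one {L : Finset C} {W : Finset V} (hu : DeadUniq c L W)
    (hc : ¬ HasRainbowTriangle c) {x : V} (hx : x ∈ W) : (deadNb c L x W).card ≤ 1 := by
  rw [Finset.card_le_one]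
  intro a ha b hb
  simp only [deadNb, Finset.mem_filter] at ha hb
  exact hu.matching hc hx ha.1 hb.1 ha.2.1.symm hb.2.1.symm ha.2.2 hb.2.2

theorem deadNb_eq_empty {L : Finset C} {W S : Finset V} {x : V} (hS : S ⊆ W)
    (h : ∀ y ∈ W, x ≠ y → c s(x, y) ∈ L) : (deadNb c L x S).card = 0 := by
  rw [Finset.card_eq_zero, Finset.eq_empty_iff_forall_notMem]
  intro y hy
  simp only [deadNb, Finset.mem_filter] at hy
  exact hy.2.2 (h y (hS hy.1) hy.2.1.symm)

theorem card_le_nb_add {L : Finset C} {α β : C} (hL : ∀ γ ∈ L, γ = α ∨ γ = β) (x : V)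
    (W : Finset V) :
    W.card ≤ 1 + (nb c α x W).card + (nb c β x W).card + (deadNb c L x W).card := by
  have : W ⊆ {x} ∪ nb c α x W ∪ nb c β x W ∪ deadNb c L x W := by
    intro y hy
    simp only [deadNb, Finset.mem_union, Finset.mem_filter, Finset.mem_singleton, mem_nb]
    have := hL (c s(x, y))
    tauto
  refine (Finset.card_le_card this).trans ?_
  refine (Finset.card_union_le _ _).trans (Nat.add_le_add_right ?_ _)
  refine (Finset.card_union_le _ _).trans (Nat.add_le_add_right ?_ _)
  exact (Finset.card_union_le _ _).trans (by simp)

theorem card_nb_eq_zero {α : C} {x : V} {W : Finset V} (h : ∀ y ∈ W, y ≠ x → c s(x, y) ≠ α) :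
    (nb c α x W).card = 0 := by
  rw [Finset.card_eq_zero, Finset.eq_empty_iff_forall_notMem]
  intro y hy
  rw [mem_nb] at hy
  exact h y hy.1 hy.2.1 hy.2.2

/-- The bound for a single live color. -/
def oneColorBound (e : ℕ) : ℕ := if 4 ≤ e then 8 else 7

/-- The bound for two live colors. -/
def twoColorBound (e : ℕ) : ℕ := min (14 + (e - 2)) 17

theorem card_le_oneColorBound (hc : ¬ HasRainbowTriangle c) (hs : StarFree c) {L : Finset C} {α : C}
    (hL : ∀ γ ∈ L, γ = α) {W : Finset V} (hu : DeadUniq c L W) :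
    W.card ≤ oneColorBound (deadEdges c L W).card := by
  have key : ∀ x, (nb c α x W).card ≤ 6 := by
    intro x
    by_contra! hlt
    have := hs.card_le_six hc hu (nb_subset c α x W) Finset.Subset.rfl (by omega)
      (fun a _ b _ _ h => hL _ h) (fun y hy => (mem_nb.1 hy).2)
    omega
  have hdeg : ∀ x, W.card ≤ 1 + (nb c α x W).card + (deadNb c L x W).card := by
    intro x
    have : W ⊆ {x} ∪ nb c α x W ∪ deadNb c L x W := by
      intro y hy
      simp only [deadNb, Finset.mem_union, Finset.mem_filter, Finset.mem_singleton, mem_nb]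
      have := hL (c s(x, y))
      tauto
    refine (Finset.card_le_card this).trans ?_
    refine (Finset.card_union_le _ _).trans (Nat.add_le_add_right ?_ _)
    exact (Finset.card_union_le _ _).trans (by simp)
  have h8 : W.card ≤ 8 := by
    rcases W.eq_empty_or_nonempty with rfl | ⟨x, hx⟩
    · simp
    · have := hu.card_deadNb_le_one hc hx
      have := key x
      have := hdeg x
      omega
  have hcov := card_covered_le c L W
  unfold oneColorBound
  split
  · exact h8
  · by_contra! hlt
    obtain ⟨u, hu', hl⟩ := exists_undead (c := c) (L := L) (Finset.Subset.refl W) (by omega)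
    have := key u
    have := hdeg u
    have := deadNb_eq_empty (Finset.Subset.refl W) hl
    omega

theorem StarFree.card_nb_le_six (hs : StarFree c) (hc : ¬ HasRainbowTriangle c) {L : Finset C}
    {α β : C} (hL : ∀ γ ∈ L, γ = α ∨ γ = β) {W R T : Finset V} (hu : DeadUniq c L W) (hR : R ⊆ W)
    (hT : ∀ a ∈ R \ T, ∀ b ∈ R \ T, a ≠ b → c s(a, b) ≠ α) {y : V}
    (hcard : 4 + T.card ≤ (nb c β y R).card) : (nb c β y W).card ≤ 6 := by
  have h1 := Finset.le_card_sdiff T (nb c β y R)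
  refine hs.card_le_six hc (S := nb c β y R \ T) (w := y) (β := β) hu ?_ ?_ (by omega) ?_ ?_
  · exact (Finset.sdiff_subset).trans ((nb_subset _ _ _ _).trans hR)
  · exact (Finset.sdiff_subset).trans (nb_mono hR)
  · intro a ha b hb hab h
    have hsub : nb c β y R \ T ⊆ R \ T := Finset.sdiff_subset_sdiff (nb_subset _ _ _ _) le_rfl
    exact (hL _ h).resolve_left (hT a (hsub ha) b (hsub hb) hab)
  · exact fun x hx => (mem_nb.1 hx).2

/-- In a large `α`-neighborhood, the `α`-edges form a star. -/
theorem StarFree.exists_star (hs : StarFree c) (hc : ¬ HasRainbowTriangle c) {L : Finset C}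
    {α β : C} (hL : ∀ γ ∈ L, γ = α ∨ γ = β) {W R : Finset V} (hu : DeadUniq c L W) (hR : R ⊆ W)
    (hi : Intersecting c α R) (h7 : 7 ≤ R.card)
    (hT : ∀ T ⊆ R, T.card = 3 → ∃ y ∈ R \ T, 7 + (deadNb c L y W).card ≤ R.card ∧
      (R.card ≤ 7 + (deadNb c L y W).card → 7 ≤ (nb c β y W).card)) :
    ∃ z ∈ R, ∀ a ∈ R.erase z, ∀ b ∈ R.erase z, a ≠ b → c s(a, b) ≠ α := by
  rcases hi.star_or_triangle (Finset.card_pos.1 (by omega)) with ⟨z, hz, hstar⟩ | ⟨T, hTR, hT3, hst⟩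
  · refine ⟨z, hz, fun a ha b hb hab h => ?_⟩
    rw [Finset.mem_erase] at ha hb
    have := hstar a ha.2 b hb.2 hab h
    tauto
  · exfalso
    obtain ⟨y, hy, hky, hβ⟩ := hT T hTR hT3
    rw [Finset.mem_sdiff] at hy
    obtain ⟨T', -, hT2, hfree⟩ := hi.exists_cover
    have h0 : (nb c α y R).card = 0 :=
      card_nb_eq_zero fun x hx hxy h => hy.2 (hst y hy.1 x hx hxy.symm h).1
    have hd := card_le_nb_add (c := c) hL y R
    have hdd : (deadNb c L y R).card ≤ (deadNb c L y W).card :=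
      Finset.card_le_card (Finset.filter_subset_filter _ hR)
    have h6 := hs.card_nb_le_six hc hL hu hR hfree (y := y) (by omega)
    have hle := Finset.card_le_card (nb_mono (c := c) (α := β) (x := y) hR)
    omega

theorem exists_subset_erase_free {α : C} {R : Finset V} {k : ℕ} (hk : k + 1 ≤ R.card)
    (h : ∃ z ∈ R, ∀ a ∈ R.erase z, ∀ b ∈ R.erase z, a ≠ b → c s(a, b) ≠ α) :
    ∃ Z ⊆ R, Z.card = k ∧ ∀ a ∈ Z, ∀ b ∈ Z, a ≠ b → c s(a, b) ≠ α := by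
  obtain ⟨z, hz, hfree⟩ := h
  obtain ⟨Z, hZ, hZk⟩ := Finset.exists_subset_card_eq (s := R.erase z) (n := k)
    (by rw [Finset.card_erase_of_mem hz]; omega)
  exact ⟨Z, hZ.trans (Finset.erase_subset _ _), hZk, fun a ha b hb => hfree a (hZ ha) b (hZ hb)⟩

/-- Degrees inside a set free of one of the two colors. -/
theorem StarFree.card_nb_le_six_of_free (hs : StarFree c) (hc : ¬ HasRainbowTriangle c)
    {L : Finset C} {α β : C} (hL : ∀ γ ∈ L, γ = α ∨ γ = β) {W Z : Finset V} (hu : DeadUniq c L W)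
    (hZW : Z ⊆ W) (hZ : ∀ a ∈ Z, ∀ b ∈ Z, a ≠ b → c s(a, b) ≠ α) {y : V} (hy : y ∈ Z)
    (hcard : 5 + (deadNb c L y W).card ≤ Z.card) :
    (nb c β y W).card ≤ 6 ∧ Z.card ≤ 1 + (nb c β y Z).card + (deadNb c L y W).card := by
  have h0 : (nb c α y Z).card = 0 := card_nb_eq_zero fun x hx hxy => hZ y hy x hx hxy.symm
  have hd := card_le_nb_add (c := c) hL y Z
  have hdd : (deadNb c L y Z).card ≤ (deadNb c L y W).card :=
    Finset.card_le_card (Finset.filter_subset_filter _ hZW)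
  refine ⟨hs.card_nb_le_six hc hL hu hZW (T := ∅) (by simpa using hZ) ?_, by omega⟩
  rw [Finset.card_empty]
  omega

theorem StarFree.card_nb_le_eight (hs : StarFree c) (hc : ¬ HasRainbowTriangle c)
    {L : Finset C} {α β : C} (hL : ∀ γ ∈ L, γ = α ∨ γ = β) {W : Finset V} (hu : DeadUniq c L W)
    (hcov : (covered c L W).card ≤ 4) (v : V) : (nb c α v W).card ≤ 8 := by
  by_contra! hlt
  have hR := nb_subset c α v W
  obtain ⟨Z, hZR, hZ8, hfree⟩ := exists_subset_erase_free (k := 8) (by omega)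
    (hs.exists_star hc hL hu hR (hs.intersecting_nb (by omega)) (by omega) (by
      intro T hTR hT3
      have := Finset.le_card_sdiff T (nb c α v W)
      obtain ⟨y, hy, hl⟩ := exists_undead (c := c) (L := L) ((Finset.sdiff_subset (t := T)).trans hR)
        (by omega)
      have := deadNb_eq_empty (Finset.Subset.refl W) hl
      exact ⟨y, hy, by omega, by omega⟩))
  have hZW := hZR.trans hR
  obtain ⟨u, hu', hl⟩ := exists_undead (c := c) (L := L) hZW (by omega)
  have h0 := deadNb_eq_empty (Finset.Subset.refl W) hl
  have h6 := hs.card_nb_le_six_of_free hc hL hu hZW hfree hu' (by omega)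
  have := Finset.card_le_card (nb_mono (c := c) (α := β) (x := u) hZW)
  omega

theorem StarFree.exists_free_seven (hs : StarFree c) (hc : ¬ HasRainbowTriangle c)
    {L : Finset C} {α β : C} (hL : ∀ γ ∈ L, γ = α ∨ γ = β) {W : Finset V} (hu : DeadUniq c L W)
    (hcov : (covered c L W).card ≤ 4) {v : V} (h8 : 8 ≤ (nb c α v W).card) :
    ∃ Z ⊆ nb c α v W, Z.card = 7 ∧ ∀ a ∈ Z, ∀ b ∈ Z, a ≠ b → c s(a, b) ≠ α := by
  have hR := nb_subset c α v W
  refine exists_subset_erase_free (by omega)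
    (hs.exists_star hc hL hu hR (hs.intersecting_nb (by omega)) (by omega) ?_)
  intro T hTR hT3
  have := Finset.le_card_sdiff T (nb c α v W)
  obtain ⟨y, hy, hl⟩ := exists_undead (c := c) (L := L) ((Finset.sdiff_subset (t := T)).trans hR)
    (by omega)
  have := deadNb_eq_empty (Finset.Subset.refl W) hl
  exact ⟨y, hy, by omega, by omega⟩

theorem StarFree.color_eq_of_free_seven (hs : StarFree c) (hc : ¬ HasRainbowTriangle c)
    {L : Finset C} {α β : C} (hL : ∀ γ ∈ L, γ = α ∨ γ = β) {W Z : Finset V} (hu : DeadUniq c L W)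
    (hZW : Z ⊆ W) (hZ7 : Z.card = 7) (hZ : ∀ a ∈ Z, ∀ b ∈ Z, a ≠ b → c s(a, b) ≠ α) {u x : V}
    (huZ : u ∈ Z) (hl : ∀ y ∈ W, u ≠ y → c s(u, y) ∈ L) (hx : x ∈ W) (hxZ : x ∉ Z) :
    c s(u, x) = α := by
  have h0 := deadNb_eq_empty (Finset.Subset.refl W) hl
  have h6 := hs.card_nb_le_six_of_free hc hL hu hZW hZ huZ (by omega)
  have hux : u ≠ x := fun h => hxZ (h ▸ huZ)
  refine (hL _ (hl x hx hux)).resolve_right fun hβ => ?_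
  have : insert x (nb c β u Z) ⊆ nb c β u W := by
    intro y hy
    rcases Finset.mem_insert.1 hy with rfl | hy
    · exact mem_nb.2 ⟨hx, hux.symm, hβ⟩
    · exact nb_mono hZW hy
  have := Finset.card_le_card this
  rw [Finset.card_insert_of_notMem fun h => hxZ (nb_subset _ _ _ _ h)] at this
  omega

theorem StarFree.card_nb_le_seven (hs : StarFree c) (hc : ¬ HasRainbowTriangle c)
    {L : Finset C} {α β : C} (hL : ∀ γ ∈ L, γ = α ∨ γ = β) {W : Finset V}
    (hu : DeadUniq c L W) (h15 : W.card = 15) (hcov : (covered c L W).card ≤ 4) (v : V) :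
    (nb c α v W).card ≤ 7 := by
  by_contra! h8
  obtain ⟨Z, hZR, hZ7, hfree⟩ := hs.exists_free_seven hc hL hu hcov h8
  have hZW := hZR.trans (nb_subset c α v W)
  obtain ⟨u, huZ, hl⟩ := exists_undead (c := c) (L := L) hZW (by omega)
  have hout := fun x => hs.color_eq_of_free_seven hc hL hu hZW hZ7 hfree (x := x) huZ hl
  have hW8 : W \ Z ⊆ nb c α u W := by
    intro x hx
    rw [Finset.mem_sdiff] at hx
    exact mem_nb.2 ⟨hx.1, fun h => hx.2 (h ▸ huZ), hout x hx.1 hx.2⟩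
  have h8' : 8 ≤ (nb c α u W).card := by
    have := Finset.card_le_card hW8
    rw [Finset.card_sdiff_of_subset hZW] at this
    omega
  obtain ⟨Z', hZR', hZ7', hfree'⟩ := hs.exists_free_seven hc hL hu hcov h8'
  have hZW' := hZR'.trans (nb_subset c α u W)
  have hdisj : Disjoint Z Z' := by
    rw [Finset.disjoint_left]
    intro x hx hx'
    have := mem_nb.1 (hZR' hx')
    exact hfree u huZ x hx this.2.1.symm this.2.2
  have hU : (Z ∪ Z').card = 14 := by rw [Finset.card_union_of_disjoint hdisj]; omega
  have hUW : Z ∪ Z' ⊆ W := Finset.union_subset hZW hZW'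
  obtain ⟨x, hx, hxU⟩ := Finset.exists_mem_notMem_of_card_lt_card (s := Z ∪ Z') (t := W) (by omega)
  rw [Finset.mem_union, not_or] at hxU
  have hsub : (Z ∪ Z') \ covered c L W ⊆ nb c α x W := by
    intro y hy
    rw [Finset.mem_sdiff] at hy
    have hyW := hUW hy.1
    have hyl : ∀ z ∈ W, y ≠ z → c s(y, z) ∈ L := by
      intro z hz hyz
      by_contra hd
      exact hy.2 (Finset.mem_filter.2 ⟨hyW, z, hz, hyz, hd⟩)
    refine mem_nb.2 ⟨hyW, fun h => ?_, ?_⟩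
    · rw [h, Finset.mem_union] at hy
      tauto
    · rw [Sym2.eq_swap]
      rcases Finset.mem_union.1 hy.1 with h | h
      · exact hs.color_eq_of_free_seven hc hL hu hZW hZ7 hfree h hyl hx hxU.1
      · exact hs.color_eq_of_free_seven hc hL hu hZW' hZ7' hfree' h hyl hx hxU.2
  have h1 := Finset.card_le_card hsub
  have h2 := Finset.le_card_sdiff (covered c L W) (Z ∪ Z')
  have h3 := hs.card_nb_le_eight hc hL hu hcov x
  omega

theorem StarFree.exists_four_covered (hs : StarFree c) (hc : ¬ HasRainbowTriangle c)
    {L : Finset C} {α β : C} (hL : ∀ γ ∈ L, γ = α ∨ γ = β) {W : Finset V}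
    (hu : DeadUniq c L W) (h15 : W.card = 15) (hcov : (covered c L W).card ≤ 4) {v : V}
    (h7 : 7 ≤ (nb c α v W).card) : ∃ Q ⊆ nb c α v W, Q ⊆ covered c L W ∧ 4 ≤ Q.card := by
  have hR := nb_subset c α v W
  by_contra! hQ
  have hα := fun x => hs.card_nb_le_seven hc hL hu h15 hcov x
  obtain ⟨Z, hZR, hZ6, hfree⟩ := exists_subset_erase_free (k := 6) (by omega)
    (hs.exists_star hc hL hu hR (hs.intersecting_nb h7) h7 (by
      intro T hTR hT3
      have h4 := Finset.le_card_sdiff T (nb c α v W)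
      have : ∃ y ∈ nb c α v W \ T, y ∉ covered c L W := by
        by_contra! h
        have := hQ _ Finset.sdiff_subset h
        omega
      obtain ⟨y, hy, hyc⟩ := this
      have hyW := hR (Finset.sdiff_subset hy)
      have h0 : (deadNb c L y W).card = 0 := deadNb_eq_empty (Finset.Subset.refl W) (by
        intro z hz hyz
        by_contra hd
        exact hyc (Finset.mem_filter.2 ⟨hyW, z, hz, hyz, hd⟩))
      have := hα y
      have := card_le_nb_add (c := c) hL y W
      exact ⟨y, hy, by omega, by omega⟩))
  have hZW := hZR.trans hR
  obtain ⟨u, huZ, hl⟩ := exists_undead (c := c) (L := L) hZW (by omega)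
  have h0 := deadNb_eq_empty (Finset.Subset.refl W) hl
  have h6 := hs.card_nb_le_six_of_free hc hL hu hZW hfree huZ (by omega)
  have := hα u
  have := card_le_nb_add (c := c) hL u W
  omega

theorem StarFree.card_ne_fifteen (hs : StarFree c) (hc : ¬ HasRainbowTriangle c)
    {L : Finset C} {α β : C} (hαβ : α ≠ β) (hL : ∀ γ ∈ L, γ = α ∨ γ = β) {W : Finset V}
    (hu : DeadUniq c L W) (hcov : (covered c L W).card ≤ 4) : W.card ≠ 15 := by
  intro h15
  have hL' : ∀ γ ∈ L, γ = β ∨ γ = α := fun γ h => (hL γ h).symm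
  obtain ⟨v, hv, hl⟩ := exists_undead (c := c) (L := L) (Finset.Subset.refl W) (by omega)
  have h0 := deadNb_eq_empty (Finset.Subset.refl W) hl
  have hd := card_le_nb_add (c := c) hL v W
  have h1 := hs.card_nb_le_seven hc hL hu h15 hcov v
  have h2 := hs.card_nb_le_seven hc hL' hu h15 hcov v
  obtain ⟨Q, hQ, hQc, hQ4⟩ := hs.exists_four_covered hc hL hu h15 hcov (v := v) (by omega)
  obtain ⟨Q', hQ', hQc', hQ4'⟩ := hs.exists_four_covered hc hL' hu h15 hcov (v := v) (by omega)
  have hdisj : Disjoint Q Q' := by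
    rw [Finset.disjoint_left]
    intro x hx hx'
    exact hαβ ((mem_nb.1 (hQ hx)).2.2.symm.trans (mem_nb.1 (hQ' hx')).2.2)
  have h3 := Finset.card_le_card (Finset.union_subset hQc hQc')
  rw [Finset.card_union_of_disjoint hdisj] at h3
  omega

theorem StarFree.card_nb_le_seven_of_eighteen (hs : StarFree c) (hc : ¬ HasRainbowTriangle c)
    {L : Finset C} {α β : C} (hL : ∀ γ ∈ L, γ = α ∨ γ = β) {W : Finset V}
    (hu : DeadUniq c L W) (h18 : W.card = 18) (v : V) : (nb c α v W).card ≤ 7 := by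
  by_contra! h8
  have hdn := fun x (hx : x ∈ W) => hu.card_deadNb_le_one hc hx
  have hR := nb_subset c α v W
  obtain ⟨T, hT, hT2, hfree⟩ := (hs.intersecting_nb (c := c) (α := α) (x := v) (W := W)
    (by omega)).exists_cover
  have hZW : nb c α v W \ T ⊆ W := Finset.sdiff_subset.trans hR
  have hZ := Finset.le_card_sdiff T (nb c α v W)
  obtain ⟨u, huZ⟩ := Finset.card_pos.1 (show 0 < (nb c α v W \ T).card by omega)
  have := hdn u (hZW huZ)
  have h6 := hs.card_nb_le_six_of_free hc hL hu hZW hfree huZ (by omega)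
  have hdu := card_le_nb_add (c := c) hL u W
  have hR2 := nb_subset c α u W
  obtain ⟨Z, hZR, hZ9, hfree9⟩ := exists_subset_erase_free (k := 9) (by omega)
    (hs.exists_star hc hL hu hR2 (hs.intersecting_nb (by omega)) (by omega) (by
      intro T hTR hT3
      have h4 := Finset.le_card_sdiff T (nb c α u W)
      obtain ⟨y, hy⟩ := Finset.card_pos.1 (show 0 < (nb c α u W \ T).card by omega)
      have := hdn y (hR2 (Finset.sdiff_subset hy))
      exact ⟨y, hy, by omega, by omega⟩))
  obtain ⟨w, hw⟩ := Finset.card_pos.1 (show 0 < Z.card by omega)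
  have hZW9 := hZR.trans hR2
  have := hdn w (hZW9 hw)
  have := hs.card_nb_le_six_of_free hc hL hu hZW9 hfree9 hw (by omega)
  have := Finset.card_le_card (nb_mono (c := c) (α := β) (x := w) hZW9)
  omega

theorem card_le_twoColorBound (hc : ¬ HasRainbowTriangle c) (hs : StarFree c) {L : Finset C}
    {α β : C} (hαβ : α ≠ β) (hL : ∀ γ ∈ L, γ = α ∨ γ = β) {W : Finset V} (hu : DeadUniq c L W) :
    W.card ≤ twoColorBound (deadEdges c L W).card := by
  have h17 : W.card ≤ 17 := by
    by_contra! h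
    obtain ⟨S, hSW, h18⟩ := Finset.exists_subset_card_eq (s := W) (n := 18) (by omega)
    have hu' := hu.mono hSW
    obtain ⟨v, hv⟩ := Finset.card_pos.1 (show 0 < S.card by omega)
    have h1 := hs.card_nb_le_seven_of_eighteen hc hL hu' h18 v
    have h2 := hs.card_nb_le_seven_of_eighteen hc (fun γ h => (hL γ h).symm) hu' h18 v
    have h3 := card_le_nb_add (c := c) hL v S
    have h4 := hu'.card_deadNb_le_one hc hv
    omega
  have small : ∀ W : Finset V, DeadUniq c L W → (deadEdges c L W).card ≤ 2 → W.card ≤ 14 := by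
    intro W hu he
    by_contra! hlt
    obtain ⟨S, hSW, h15⟩ := Finset.exists_subset_card_eq (s := W) (n := 15) (by omega)
    have h1 := card_covered_le c L S
    have h2 := Finset.card_le_card (deadEdges_mono c L hSW)
    exact hs.card_ne_fifteen hc hαβ hL (hu.mono hSW) (by omega) h15
  have key : ∀ e (W : Finset V), DeadUniq c L W → (deadEdges c L W).card ≤ e →
      W.card ≤ 14 + (e - 2) := by
    intro e
    induction e with
    | zero => exact fun W hu he => (small W hu (by omega)).trans (by omega)
    | succ e ih =>
      intro W hu he
      by_cases h2 : (deadEdges c L W).card ≤ 2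
      · exact (small W hu h2).trans (by omega)
      · obtain ⟨s, hsd⟩ := Finset.card_pos.1 (show 0 < (deadEdges c L W).card by omega)
        induction s with
        | _ x y =>
          have hxW := (mk_mem_deadEdges.1 hsd).1
          have hlt : (deadEdges c L (W.erase x)).card < (deadEdges c L W).card := by
            apply Finset.card_lt_card
            rw [Finset.ssubset_iff_of_subset (deadEdges_mono c L (Finset.erase_subset _ _))]
            refine ⟨_, hsd, fun h => ?_⟩
            exact absurd (mk_mem_deadEdges.1 h).1 (Finset.notMem_erase x W)
          have := ih _ (hu.mono (Finset.erase_subset x W)) (by omega)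
          rw [Finset.card_erase_of_mem hxW] at this
          omega
  unfold twoColorBound
  exact le_min (key _ W hu le_rfl) h17

end FewColors

section Joins

open scoped Classical

variable {V C : Type*} {c : Sym2 V → C}

/-- The function `u` of the number of dead edges bounds the size of every vertex set in which the
dead colors occur at most once. -/
def BoundedBy (c : Sym2 V → C) (L : Finset C) (u : ℕ → ℕ) : Prop :=
  ∀ S : Finset V, DeadUniq c L S → S.card ≤ u (deadEdges c L S).card

theorem BoundedBy.exists_le {L : Finset C} {u : ℕ → ℕ} {α : C} (hb : BoundedBy c (L.erase α) u)
    {S : Finset V} (hu : DeadUniq c L S) (hα : (colorEdges c α S).card ≤ 1) :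
    ∃ e, e ≤ (deadEdges c L S).card + (colorEdges c α S).card ∧ S.card ≤ u e :=
  ⟨_, card_deadEdges_erase_le c L S α, hb S (hu.erase α hα)⟩

theorem exists_mk_of_card_colorEdges_pos {β : C} {S : Finset V}
    (h : 0 < (colorEdges c β S).card) : ∃ a ∈ S, ∃ b ∈ S, a ≠ b ∧ c s(a, b) = β := by
  obtain ⟨s, hs⟩ := Finset.card_pos.1 h
  induction s with
  | _ a b =>
    have := mk_mem_colorEdges.1 hs
    exact ⟨a, this.1, b, this.2.1, this.2.2⟩

/-- Two edges sharing a vertex, whose other ends are joined to many common neighbors. -/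
theorem StarFree.eq_of_common_vertex (hs : StarFree c) {β : C} {Q : Finset V} {a b b' : V}
    (hab : a ≠ b) (hab' : a ≠ b') (h : c s(a, b) = β) (h' : c s(a, b') = β)
    (haQ : ∀ y ∈ Q, y ≠ a ∧ c s(a, y) = β) (hbQ : b ∉ Q) (hbQ' : b' ∉ Q) (h5 : 5 ≤ Q.card)
    {x y : V} (hx : x ∈ Q) (hy : y ∈ Q) (hxy : x ≠ y) (hbx : c s(b, x) = β)
    (hby : c s(b', y) = β) : b = b' := by
  by_contra hbb
  have hcard : 7 ≤ (insert b (insert b' Q)).card := by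
    rw [Finset.card_insert_of_notMem (by simp [hbb, hbQ]), Finset.card_insert_of_notMem hbQ']
    omega
  have hi := hs a β _ hcard (by
    intro z hz
    rcases Finset.mem_insert.1 hz with rfl | hz
    · exact ⟨hab.symm, h⟩
    rcases Finset.mem_insert.1 hz with rfl | hz
    · exact ⟨hab'.symm, h'⟩
    · exact haQ z hz)
  have n1 : b ≠ x := fun e => hbQ (e ▸ hx)
  have n2 : b' ≠ y := fun e => hbQ' (e ▸ hy)
  have n3 : b ≠ y := fun e => hbQ (e ▸ hy)
  have n4 : b' ≠ x := fun e => hbQ' (e ▸ hx)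
  have := hi b (by simp) x (by simp [hx]) b' (by simp) y (by simp [hy]) n1 n2 hbx hby
  tauto

theorem mk_eq_of_intersecting {β : C} {S : Finset V} (hi : Intersecting c β S)
    (hshare : ∀ a ∈ S, ∀ b ∈ S, ∀ b' ∈ S, a ≠ b → a ≠ b' → c s(a, b) = β → c s(a, b') = β → b = b')
    {a b a' b' : V} (ha : a ∈ S) (hb : b ∈ S) (ha' : a' ∈ S) (hb' : b' ∈ S) (hab : a ≠ b)
    (hab' : a' ≠ b') (h : c s(a, b) = β) (h' : c s(a', b') = β) : s(a, b) = s(a', b') := by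
  have sw : ∀ x y, c s(x, y) = β → c s(y, x) = β := fun x y h => by rwa [Sym2.eq_swap]
  rcases hi a ha b hb a' ha' b' hb' hab hab' h h' with e | e | e | e
  · subst e
    rw [hshare a ha b hb b' hb' hab hab' h h']
  · subst e
    rw [hshare a ha b hb a' ha' hab hab'.symm h (sw _ _ h'), Sym2.eq_swap]
  · subst e
    rw [hshare b hb a ha b' hb' hab.symm hab' (sw _ _ h) h', Sym2.eq_swap]
  · subst e
    rw [hshare b hb a ha a' ha' hab.symm hab'.symm (sw _ _ h) (sw _ _ h')]

theorem StarFree.card_colorEdges_le_one_of_join (hs : StarFree c) {β : C} {P Q : Finset V}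
    (hd : Disjoint P Q) (hPQ : ∀ x ∈ P, ∀ y ∈ Q, c s(x, y) = β) (hP : 7 ≤ P.card)
    (hQ : 5 ≤ Q.card) : (colorEdges c β P).card ≤ 1 := by
  obtain ⟨x, hx, y, hy, hxy⟩ := Finset.one_lt_card.1 (show 1 < Q.card by omega)
  have hne : ∀ z ∈ P, ∀ w ∈ Q, z ≠ w := fun z hz w hw e => Finset.disjoint_left.1 hd hz (e ▸ hw)
  have hi := hs x β P hP fun z hz => ⟨hne z hz x hx, by rw [Sym2.eq_swap]; exact hPQ z hz x hx⟩
  refine card_colorEdges_le_one fun a ha b hb a' ha' b' hb' hab hab' h h' => ?_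
  refine mk_eq_of_intersecting hi ?_ ha hb ha' hb' hab hab' h h'
  intro a ha b hb b' hb' hab hab' h h'
  exact hs.eq_of_common_vertex hab hab' h h' (fun z hz => ⟨(hne a ha z hz).symm, hPQ a ha z hz⟩)
    (Finset.disjoint_left.1 hd hb) (Finset.disjoint_left.1 hd hb') hQ hx hy hxy (hPQ b hb x hx)
    (hPQ b' hb' y hy)

/-- There are no edges of color `β` in both of two sets joined in color `β`, if the second one
is contained in a large `β`-neighborhood. -/
theorem StarFree.false_of_join (hs : StarFree c) {β : C} {Q S : Finset V} {a b a' b' : V}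
    (hab : a ≠ b) (hab' : a' ≠ b') (h : c s(a, b) = β) (h' : c s(a', b') = β)
    (ha' : a' ∈ Q) (hb' : b' ∈ Q) (hbQ : ∀ y ∈ Q, y ≠ b ∧ c s(b, y) = β)
    (hQS : Q ⊆ S) (haS : ∀ y ∈ S, y ≠ a ∧ c s(a, y) = β) (hQ : 3 ≤ Q.card) (hS : 7 ≤ S.card) :
    False := by
  obtain ⟨x, hx, hxn⟩ := Finset.exists_mem_notMem_of_card_lt_card (s := {a', b'}) (t := Q)
    (lt_of_le_of_lt Finset.card_le_two (by omega))
  simp only [Finset.mem_insert, Finset.mem_singleton, not_or] at hxn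
  have hi := hs a β (insert b S)
    (hS.trans (Finset.card_le_card (Finset.subset_insert b S))) (by
      intro z hz
      rcases Finset.mem_insert.1 hz with rfl | hz
      · exact ⟨hab.symm, h⟩
      · exact haS z hz)
  have hm : ∀ z ∈ Q, z ∈ insert b S := fun z hz => Finset.mem_insert_of_mem (hQS hz)
  have := hi b (Finset.mem_insert_self _ _) x (hm x hx) a' (hm a' ha') b' (hm b' hb')
    (hbQ x hx).1.symm hab' (hbQ x hx).2 h'
  have h1 := (hbQ a' ha').1
  have h2 := (hbQ b' hb').1
  tauto

/-- Sets split into two parts joined in one color. -/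
theorem StarFree.card_join_le (hs : StarFree c) {L : Finset C} {β : C} {u : ℕ → ℕ}
    (hb : BoundedBy c (L.erase β) u) (hu7 : ∀ e, 7 ≤ u e) {W P Q : Finset V} (hu : DeadUniq c L W)
    (hP0 : P.Nonempty) (hQ0 : Q.Nonempty) (hd : Disjoint P Q) (hW : P ∪ Q = W)
    (hPQ : ∀ x ∈ P, ∀ y ∈ Q, c s(x, y) = β) :
    ∃ e₁ e₂, e₁ + e₂ ≤ (deadEdges c L W).card + 1 ∧ W.card ≤ u e₁ + u e₂ := by
  wlog hle : Q.card ≤ P.card generalizing P Q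
  · refine this hQ0 hP0 hd.symm (by rwa [Finset.union_comm]) (fun x hx y hy => ?_) (by omega)
    rw [Sym2.eq_swap]
    exact hPQ y hy x hx
  have hPW : P ⊆ W := hW ▸ Finset.subset_union_left
  have hQW : Q ⊆ W := hW ▸ Finset.subset_union_right
  have hcard : W.card = P.card + Q.card := by rw [← hW, Finset.card_union_of_disjoint hd]
  have hne : ∀ z ∈ P, ∀ w ∈ Q, z ≠ w := fun z hz w hw e => Finset.disjoint_left.1 hd hz (e ▸ hw)
  have hsum : (deadEdges c L P).card + (deadEdges c L Q).card ≤ (deadEdges c L W).card :=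
    card_insideEdges_add_le hPW hQW hd
  have hQP : ∀ y ∈ Q, ∀ x ∈ P, c s(y, x) = β := fun y hy x hx => by
    rw [Sym2.eq_swap]
    exact hPQ x hx y hy
  have h70 := hu7 0
  by_cases hP8 : P.card ≤ 7
  · exact ⟨0, 0, by omega, by omega⟩
  by_cases hQ4 : Q.card ≤ 4
  · obtain ⟨y, hy⟩ := hQ0
    obtain ⟨T, -, hT2, hfree⟩ := (hs y β P (by omega)
      fun z hz => ⟨hne z hz y hy, hQP y hy z hz⟩).exists_cover
    have h0 := card_colorEdges_eq_zero hfree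
    obtain ⟨e, he, hle⟩ := hb.exists_le (S := P \ T)
      (hu.mono (Finset.sdiff_subset.trans hPW)) (by omega)
    have h1 := Finset.le_card_sdiff T P
    have h2 := Finset.card_le_card (deadEdges_mono c L (Finset.sdiff_subset (s := P) (t := T)))
    exact ⟨e, 0, by omega, by omega⟩
  have hP1 := hs.card_colorEdges_le_one_of_join hd hPQ (by omega) (by omega)
  obtain ⟨e₁, he₁, hle₁⟩ := hb.exists_le (hu.mono hPW) hP1
  by_cases hQ6 : Q.card ≤ 6
  · exact ⟨e₁, 0, by omega, by omega⟩
  have hQ1 := hs.card_colorEdges_le_one_of_join hd.symm hQP (by omega) (by omega)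
  obtain ⟨e₂, he₂, hle₂⟩ := hb.exists_le (hu.mono hQW) hQ1
  refine ⟨e₁, e₂, ?_, by omega⟩
  by_contra! hlt
  obtain ⟨a, ha, b, hb, hab, h⟩ := exists_mk_of_card_colorEdges_pos (c := c) (β := β) (S := P)
    (by omega)
  obtain ⟨a', ha', b', hb', hab', h'⟩ := exists_mk_of_card_colorEdges_pos (c := c) (β := β) (S := Q)
    (by omega)
  exact hs.false_of_join hab hab' h h' ha' hb'
    (fun y hy => ⟨(hne b hb y hy).symm, hPQ b hb y hy⟩) Finset.Subset.rfl
    (fun y hy => ⟨(hne a ha y hy).symm, hPQ a ha y hy⟩) (by omega) (by omega)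

/-- A homogeneous partition in which the colors between parts are `α` and `β`, each part having
neighbors in both colors. -/
structure IsReducedPartition (c : Sym2 V → C) (W : Finset V) (q : ℕ) (p : V → Fin q)
    (r : Fin q → V) (α β : C) : Prop extends IsHomogeneousPartition c W q p r where
  ne : α ≠ β
  color_mem : ∀ i j, i ≠ j → c s(r i, r j) = α ∨ c s(r i, r j) = β
  exists_left : ∀ i, ∃ j, i ≠ j ∧ c s(r i, r j) = α
  exists_right : ∀ i, ∃ j, i ≠ j ∧ c s(r i, r j) = β

theorem IsReducedPartition.swap {W : Finset V} {q : ℕ} {p : V → Fin q} {r : Fin q → V} {α β : C}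
    (h : IsReducedPartition c W q p r α β) : IsReducedPartition c W q p r β α :=
  ⟨h.toIsHomogeneousPartition, h.ne.symm, fun i j hij => (h.color_mem i j hij).symm,
    h.exists_right, h.exists_left⟩

theorem IsReducedPartition.left_mem {W : Finset V} {q : ℕ} {p : V → Fin q} {r : Fin q → V}
    {α β : C} (h : IsReducedPartition c W q p r α β) (hq : 3 ≤ q) {L : Finset C}
    (hu : DeadUniq c L W) : α ∈ L := by
  by_contra hα
  have hinj : ∀ i j, r i = r j → i = j := fun i j e => by
    rw [← h.rep_label i, e, h.rep_label j]
  have hdead : ∀ i j, i ≠ j → c s(r i, r j) = α → s(r i, r j) ∈ deadEdges c L W := fun i j hij e =>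
    mk_mem_deadEdges.2 ⟨h.rep_mem i, h.rep_mem j, fun e => hij (hinj i j e), by rwa [e]⟩
  obtain ⟨j, hj, hjα⟩ := h.exists_left ⟨0, by omega⟩
  obtain ⟨k, -, hk⟩ := Finset.exists_mem_notMem_of_card_lt_card
    (s := ({⟨0, by omega⟩, j} : Finset (Fin q))) (t := Finset.univ)
    (lt_of_le_of_lt Finset.card_le_two (by rw [Finset.card_fin]; omega))
  simp only [Finset.mem_insert, Finset.mem_singleton, not_or] at hk
  obtain ⟨l, hl, hlα⟩ := h.exists_left k
  have := hu _ (hdead _ _ hj hjα) _ (hdead _ _ hl hlα) (hjα.trans hlα.symm)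
  rw [Sym2.eq_iff] at this
  rcases this with ⟨e, -⟩ | ⟨-, e⟩
  · exact hk.1 (hinj _ _ e).symm
  · exact hk.2 (hinj _ _ e).symm

/-- A subset of a partitioned set in which the edges of one of the two reduced colors pairwise
intersect. -/
theorem StarFree.card_le_of_intersecting (hs : StarFree c) {L : Finset C} {W R : Finset V}
    {q : ℕ} {p : V → Fin q} {r : Fin q → V} {α β : C} (h : IsReducedPartition c W q p r α β)
    {u : ℕ → ℕ} (hb : BoundedBy c ((L.erase α).erase β) u) (hu7 : ∀ e, 7 ≤ u e)
    (hu : DeadUniq c L W) (hR : R ⊆ W) (hi : 7 ≤ R.card → Intersecting c α R) :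
    ∃ e₁ e₂, e₁ + e₂ ≤ (deadEdges c L R).card + 1 ∧ R.card ≤ 2 + (u e₁ + u e₂) := by
  have h70 := hu7 0
  by_cases h7 : R.card ≤ 6
  · exact ⟨0, 0, by omega, by omega⟩
  obtain ⟨T, -, hT2, hfree⟩ := (hi (by omega)).exists_cover
  have h0 := card_colorEdges_eq_zero hfree
  have huR : DeadUniq c (L.erase α) (R \ T) :=
    (hu.mono (Finset.sdiff_subset.trans hR)).erase α (by omega)
  have hdR := card_deadEdges_erase_le c L (R \ T) α
  have h1 := Finset.le_card_sdiff T R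
  have h2 := Finset.card_le_card (deadEdges_mono c L (Finset.sdiff_subset (s := R) (t := T)))
  have hRW : R \ T ⊆ W := Finset.sdiff_subset.trans hR
  by_cases hone : ∃ i, ∀ x ∈ R \ T, p x = i
  · obtain ⟨i, hone⟩ := hone
    by_cases h6 : (R \ T).card ≤ 6
    · exact ⟨0, 0, by omega, by omega⟩
    obtain ⟨j, hij, hβ⟩ := h.exists_right i
    have hi' : Intersecting c β (R \ T) := by
      refine hs (r j) β _ (by omega) fun x hx => ?_
      have hne : p (r j) ≠ p x := by
        rw [hone x hx, h.rep_label]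
        exact hij.symm
      refine ⟨fun e => hne (by rw [e]), ?_⟩
      rw [h.color_eq _ (h.rep_mem j) _ (hRW hx) hne, hone x hx, h.rep_label, Sym2.eq_swap, hβ]
    obtain ⟨T', -, hT2', hfree'⟩ := hi'.exists_cover
    have h0' := card_colorEdges_eq_zero hfree'
    obtain ⟨e, he, hle⟩ := hb.exists_le (S := (R \ T) \ T')
      (huR.mono Finset.sdiff_subset) (by omega)
    have h1' := Finset.le_card_sdiff T' (R \ T)
    have h2' := Finset.card_le_card
      (deadEdges_mono c (L.erase α) (Finset.sdiff_subset (s := R \ T) (t := T')))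
    exact ⟨e, 0, by omega, by omega⟩
  · push Not at hone
    obtain ⟨x, hx⟩ := Finset.card_pos.1 (show 0 < (R \ T).card by omega)
    obtain ⟨y, hy, hyx⟩ := hone (p x)
    obtain ⟨e₁, e₂, he, hle⟩ := hs.card_join_le hb hu7 huR
      (P := (R \ T).filter fun z => p z = p x) (Q := (R \ T).filter fun z => ¬ p z = p x)
      ⟨x, by simp [Finset.mem_sdiff.1 hx]⟩ ⟨y, by simp [Finset.mem_sdiff.1 hy, hyx]⟩
      (Finset.disjoint_filter_filter_not _ _ _) (Finset.filter_union_filter_not_eq _ _) (by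
        intro a ha b hb
        rw [Finset.mem_filter] at ha hb
        have hne : p a ≠ p b := fun e => hb.2 (e.symm.trans ha.2)
        have hcol := h.color_eq a (hRW ha.1) b (hRW hb.1) hne
        have hα := hfree a ha.1 b hb.1 fun e => hne (by rw [e])
        rw [hcol] at hα ⊢
        exact (h.color_mem _ _ hne).resolve_left hα)
    exact ⟨e₁, e₂, by omega, by omega⟩

end Joins

section ReducedPartition

open scoped Classical

variable {V C : Type*} {c : Sym2 V → C}

/-- The part with label `i`. -/
noncomputable def part {q : ℕ} (p : V → Fin q) (W : Finset V) (i : Fin q) : Finset V :=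
  W.filter fun x => p x = i

theorem mem_part {q : ℕ} {p : V → Fin q} {W : Finset V} {i : Fin q} {x : V} :
    x ∈ part p W i ↔ x ∈ W ∧ p x = i := Finset.mem_filter

theorem part_subset {q : ℕ} (p : V → Fin q) (W : Finset V) (i : Fin q) : part p W i ⊆ W :=
  Finset.filter_subset _ _

theorem disjoint_part {q : ℕ} (p : V → Fin q) (W : Finset V) {i j : Fin q} (hij : i ≠ j) :
    Disjoint (part p W i) (part p W j) := by
  rw [Finset.disjoint_left]
  intro x hx hx'
  exact hij ((mem_part.1 hx).2.symm.trans (mem_part.1 hx').2)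

theorem card_part_union {q : ℕ} (p : V → Fin q) (W : Finset V) {i j : Fin q} (hij : i ≠ j) :
    (part p W i ∪ part p W j).card = (part p W i).card + (part p W j).card :=
  Finset.card_union_of_disjoint (disjoint_part p W hij)

variable {W : Finset V} {q : ℕ} {p : V → Fin q} {r : Fin q → V} {α β : C}

theorem IsReducedPartition.color_part (h : IsReducedPartition c W q p r α β) {i j : Fin q}
    (hij : i ≠ j) {x y : V} (hx : x ∈ part p W i) (hy : y ∈ part p W j) :
    y ≠ x ∧ c s(x, y) = c s(r i, r j) := by
  rw [mem_part] at hx hy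
  have hne : p x ≠ p y := by rwa [hx.2, hy.2]
  refine ⟨fun e => hne (by rw [e]), ?_⟩
  rw [h.color_eq x hx.1 y hy.1 hne, hx.2, hy.2]

theorem IsReducedPartition.rep_mem_part (h : IsReducedPartition c W q p r α β) (i : Fin q) :
    r i ∈ part p W i := mem_part.2 ⟨h.rep_mem i, h.rep_label i⟩

theorem StarFree.card_le_of_small_part (hs : StarFree c) {L : Finset C}
    (h : IsReducedPartition c W q p r α β)
    {u : ℕ → ℕ} (hb : BoundedBy c ((L.erase α).erase β) u) (hu7 : ∀ e, 7 ≤ u e)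
    (hu : DeadUniq c L W) {i : Fin q} (hi : (part p W i).card ≤ 3) :
    ∃ e₁ e₂ e₃ e₄ e₅, e₁ + e₂ + e₃ + e₄ + e₅ ≤ (deadEdges c L W).card + 2 ∧
      W.card ≤ u e₁ + u e₂ + u e₃ + u e₄ + u e₅ := by
  have hsub : ∀ γ, W.filter (fun y => p y ≠ i ∧ c s(r i, y) = γ) ⊆ W :=
    fun γ => Finset.filter_subset _ _
  have hint : ∀ γ, 7 ≤ (W.filter fun y => p y ≠ i ∧ c s(r i, y) = γ).card →
      Intersecting c γ (W.filter fun y => p y ≠ i ∧ c s(r i, y) = γ) := by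
    intro γ h7
    refine hs (r i) γ _ h7 fun x hx => ?_
    rw [Finset.mem_filter] at hx
    exact ⟨fun e => hx.2.1 (by rw [e, h.rep_label]), hx.2.2⟩
  obtain ⟨e₁, e₂, he, hle⟩ := hs.card_le_of_intersecting h hb hu7 hu (hsub α) (hint α)
  obtain ⟨e₃, e₄, he', hle'⟩ := hs.card_le_of_intersecting h.swap
    (by rwa [Finset.erase_right_comm]) hu7 hu (hsub β) (hint β)
  have hdisj : Disjoint (W.filter fun y => p y ≠ i ∧ c s(r i, y) = α)
      (W.filter fun y => p y ≠ i ∧ c s(r i, y) = β) := by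
    rw [Finset.disjoint_left]
    intro x hx hx'
    rw [Finset.mem_filter] at hx hx'
    exact h.ne (hx.2.2.symm.trans hx'.2.2)
  have hdead := card_insideEdges_add_le (K := fun s => c s ∉ L) (hsub α) (hsub β) hdisj
  have hW : W ⊆ part p W i ∪ (W.filter (fun y => p y ≠ i ∧ c s(r i, y) = α) ∪
      W.filter fun y => p y ≠ i ∧ c s(r i, y) = β) := by
    intro x hx
    by_cases hxi : p x = i
    · exact Finset.mem_union_left _ (mem_part.2 ⟨hx, hxi⟩)
    · have h1 := h.color_part (Ne.symm hxi) (h.rep_mem_part i) (mem_part.2 ⟨hx, rfl⟩)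
      have h2 := h.color_mem i (p x) (Ne.symm hxi)
      rw [← h1.2] at h2
      simp only [Finset.mem_union, Finset.mem_filter]
      tauto
  have h1 := (Finset.card_le_card hW).trans (Finset.card_union_le _ _)
  rw [Finset.card_union_of_disjoint hdisj] at h1
  have := hu7 0
  unfold deadEdges at *
  exact ⟨e₁, e₂, e₃, e₄, 0, by omega, by omega⟩

theorem IsReducedPartition.intersecting_two_parts (h : IsReducedPartition c W q p r α β)
    (hs : StarFree c) (h4 : ∀ i, 4 ≤ (part p W i).card) {i j k : Fin q} {γ : C} (hij : i ≠ j)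
    (hik : i ≠ k) (hjk : j ≠ k) (hj : c s(r i, r j) = γ) (hk : c s(r i, r k) = γ) :
    Intersecting c γ (part p W j ∪ part p W k) := by
  refine hs (r i) γ _ ?_ fun x hx => ?_
  · rw [card_part_union p W hjk]
    have := h4 j
    have := h4 k
    omega
  · rcases Finset.mem_union.1 hx with hx | hx
    · exact (h.color_part hij (h.rep_mem_part i) hx).imp id fun e => e.trans hj
    · exact (h.color_part hik (h.rep_mem_part i) hx).imp id fun e => e.trans hk

theorem IsReducedPartition.no_triangle (h : IsReducedPartition c W q p r α β)
    (hs : StarFree c) (h4 : ∀ i, 4 ≤ (part p W i).card) {i j k : Fin q} {γ : C} (hij : i ≠ j)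
    (hik : i ≠ k) (hjk : j ≠ k) (hj : c s(r i, r j) = γ) (hk : c s(r i, r k) = γ) :
    c s(r j, r k) ≠ γ := by
  intro hγ
  have hi := h.intersecting_two_parts hs h4 hij hik hjk hj hk
  obtain ⟨a, ha, a', ha', haa⟩ := Finset.one_lt_card.1 (lt_of_lt_of_le (by omega) (h4 j))
  obtain ⟨b, hb, b', hb', hbb⟩ := Finset.one_lt_card.1 (lt_of_lt_of_le (by omega) (h4 k))
  have h1 := h.color_part hjk ha hb
  have h2 := h.color_part hjk ha' hb'
  have h3 := h.color_part hjk ha hb'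
  have h5 := h.color_part hjk ha' hb
  have := hi a (Finset.mem_union_left _ ha) b (Finset.mem_union_right _ hb) a'
    (Finset.mem_union_left _ ha') b' (Finset.mem_union_right _ hb') h1.1.symm h2.1.symm
    (h1.2.trans hγ) (h2.2.trans hγ)
  have := h3.1
  have := h5.1
  tauto

/-- The parts joined to part `i` in color `γ`. -/
noncomputable def partNb (c : Sym2 V → C) (r : Fin q → V) (γ : C) (i : Fin q) : Finset (Fin q) :=
  Finset.univ.filter fun j => i ≠ j ∧ c s(r i, r j) = γ

theorem mem_partNb {γ : C} {i j : Fin q} :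
    j ∈ partNb c r γ i ↔ i ≠ j ∧ c s(r i, r j) = γ := by
  simp [partNb]

theorem IsReducedPartition.card_partNb_le_two (h : IsReducedPartition c W q p r α β)
    (hs : StarFree c) (h4 : ∀ i, 4 ≤ (part p W i).card) (i : Fin q) :
    (partNb c r α i).card ≤ 2 := by
  by_contra! hlt
  obtain ⟨j, k, l, hj, hk, hl, hjk, hjl, hkl⟩ := Finset.two_lt_card_iff.1 hlt
  rw [mem_partNb] at hj hk hl
  have h1 := (h.color_mem j k hjk).resolve_left (h.no_triangle hs h4 hj.1 hk.1 hjk hj.2 hk.2)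
  have h2 := (h.color_mem j l hjl).resolve_left (h.no_triangle hs h4 hj.1 hl.1 hjl hj.2 hl.2)
  have h3 := (h.color_mem k l hkl).resolve_left (h.no_triangle hs h4 hk.1 hl.1 hkl hk.2 hl.2)
  exact h.no_triangle hs h4 hjk hjl hkl h1 h2 h3

theorem IsReducedPartition.card_partNb_add (h : IsReducedPartition c W q p r α β) (i : Fin q) :
    (partNb c r α i).card + (partNb c r β i).card = q - 1 := by
  rw [← Finset.card_union_of_disjoint]
  · have : partNb c r α i ∪ partNb c r β i = Finset.univ.erase i := by
      ext j
      simp only [Finset.mem_union, mem_partNb, Finset.mem_erase, Finset.mem_univ, and_true]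
      have := h.color_mem i j
      grind
    rw [this, Finset.card_erase_of_mem (Finset.mem_univ i), Finset.card_fin]
  · rw [Finset.disjoint_left]
    intro j hj hj'
    rw [mem_partNb] at hj hj'
    exact h.ne (hj.2.symm.trans hj'.2)

theorem IsReducedPartition.exists_mono_path {r : Fin 4 → V} {p : V → Fin 4}
    (h : IsReducedPartition c W 4 p r α β) : ∃ i j k l : Fin 4, i ≠ j ∧ i ≠ k ∧ i ≠ l ∧ j ≠ k ∧
      j ≠ l ∧ k ≠ l ∧ ∃ γ, (γ = α ∨ γ = β) ∧ c s(r k, r i) = γ ∧ c s(r k, r j) = γ ∧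
        c s(r i, r l) = γ := by
  have key : ∀ a b t : Fin 4, 0 ≠ a → 0 ≠ b → 0 ≠ t → a ≠ b → a ≠ t → b ≠ t → ∀ γ,
      (γ = α ∨ γ = β) → c s(r 0, r a) = γ → c s(r 0, r b) = γ → c s(r 0, r t) ≠ γ →
      ∃ i j k l : Fin 4, i ≠ j ∧ i ≠ k ∧ i ≠ l ∧ j ≠ k ∧
      j ≠ l ∧ k ≠ l ∧ ∃ γ, (γ = α ∨ γ = β) ∧ c s(r k, r i) = γ ∧ c s(r k, r j) = γ ∧
        c s(r i, r l) = γ := by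
    intro a b t h0a h0b h0t hab hat hbt γ hγ ha hb ht
    have hex : ∃ j, t ≠ j ∧ c s(r t, r j) = γ := by
      rcases hγ with rfl | rfl
      · exact h.exists_left t
      · exact h.exists_right t
    obtain ⟨j, htj, hj⟩ := hex
    have hj0 : j ≠ 0 := by
      rintro rfl
      rw [Sym2.eq_swap] at hj
      exact ht hj
    have hjab : j = a ∨ j = b := by omega
    rcases hjab with rfl | rfl
    · exact ⟨0, t, j, b, h0t, h0a, h0b, hat.symm, hbt.symm, hab, γ, hγ,
        by rwa [Sym2.eq_swap], by rwa [Sym2.eq_swap], hb⟩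
    · exact ⟨0, t, j, a, h0t, h0b, h0a, hbt.symm, hat.symm, hab.symm, γ, hγ,
        by rwa [Sym2.eq_swap], by rwa [Sym2.eq_swap], ha⟩
  have hl := h.exists_left 0
  have hr := h.exists_right 0
  have hne := h.ne
  have c1 := h.color_mem 0 1 (by decide)
  have c2 := h.color_mem 0 2 (by decide)
  have c3 := h.color_mem 0 3 (by decide)
  have k3 := key 1 2 3 (by decide) (by decide) (by decide) (by decide) (by decide) (by decide)
  have k2 := key 1 3 2 (by decide) (by decide) (by decide) (by decide) (by decide) (by decide)
  have k1 := key 2 3 1 (by decide) (by decide) (by decide) (by decide) (by decide) (by decide)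
  have all : ∀ γ, c s(r 0, r 1) = γ → c s(r 0, r 2) = γ → c s(r 0, r 3) = γ →
      ∀ j, 0 ≠ j → c s(r 0, r j) = γ := by
    intro γ h1 h2 h3 j hj
    have : j = 1 ∨ j = 2 ∨ j = 3 := by omega
    rcases this with rfl | rfl | rfl <;> assumption
  obtain ⟨j, hj, hjα⟩ := hl
  obtain ⟨j', hj', hjβ⟩ := hr
  have hA : ¬ (c s(r 0, r 1) = α ∧ c s(r 0, r 2) = α ∧ c s(r 0, r 3) = α) := fun h =>
    hne ((all α h.1 h.2.1 h.2.2 j' hj').symm.trans hjβ)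
  have hB : ¬ (c s(r 0, r 1) = β ∧ c s(r 0, r 2) = β ∧ c s(r 0, r 3) = β) := fun h =>
    hne (hjα.symm.trans (all β h.1 h.2.1 h.2.2 j hj))
  rcases c1 with e1 | e1 <;> rcases c2 with e2 | e2 <;> rcases c3 with e3 | e3
  · exact absurd ⟨e1, e2, e3⟩ hA
  · exact k3 α (Or.inl rfl) e1 e2 (by rw [e3]; exact hne.symm)
  · exact k2 α (Or.inl rfl) e1 e3 (by rw [e2]; exact hne.symm)
  · exact k1 β (Or.inr rfl) e2 e3 (by rw [e1]; exact hne)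
  · exact k1 α (Or.inl rfl) e2 e3 (by rw [e1]; exact hne.symm)
  · exact k2 β (Or.inr rfl) e1 e3 (by rw [e2]; exact hne)
  · exact k3 β (Or.inr rfl) e1 e2 (by rw [e3]; exact hne)
  · exact absurd ⟨e1, e2, e3⟩ hB

theorem StarFree.card_le_of_four_parts (hs : StarFree c) {L : Finset C} {r : Fin 4 → V}
    {p : V → Fin 4} (h : IsReducedPartition c W 4 p r α β) (h4 : ∀ i, 4 ≤ (part p W i).card)
    {u : ℕ → ℕ} (hb : BoundedBy c ((L.erase α).erase β) u) (hu7 : ∀ e, 7 ≤ u e)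
    (hu : DeadUniq c L W) :
    ∃ e₁ e₂ e₃ e₄ e₅, e₁ + e₂ + e₃ + e₄ + e₅ ≤ (deadEdges c L W).card + 2 ∧
      W.card ≤ u e₁ + u e₂ + u e₃ + u e₄ + u e₅ := by
  obtain ⟨i, j, k, l, hij, hik, hil, hjk, hjl, hkl, γ, hγ, hki, hkj, hil'⟩ := h.exists_mono_path
  have hI := h.intersecting_two_parts hs h4 hik.symm hjk.symm hij hki hkj
  have hI' := h.intersecting_two_parts hs h4 hik hil hkl (by rwa [Sym2.eq_swap]) hil'
  have hsub : ∀ a b, part p W a ∪ part p W b ⊆ W := fun a b =>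
    Finset.union_subset (part_subset _ _ _) (part_subset _ _ _)
  have half : ∀ R ⊆ W, Intersecting c γ R → ∃ e₁ e₂, e₁ + e₂ ≤ (deadEdges c L R).card + 1 ∧
      R.card ≤ 2 + (u e₁ + u e₂) := by
    intro R hR hI
    rcases hγ with rfl | rfl
    · exact hs.card_le_of_intersecting h hb hu7 hu hR fun _ => hI
    · exact hs.card_le_of_intersecting h.swap (by rwa [Finset.erase_right_comm]) hu7 hu hR
        fun _ => hI
  obtain ⟨e₁, e₂, he, hle⟩ := half _ (hsub i j) hI
  obtain ⟨e₃, e₄, he', hle'⟩ := half _ (hsub k l) hI'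
  have hdisj : Disjoint (part p W i ∪ part p W j) (part p W k ∪ part p W l) := by
    simp only [Finset.disjoint_union_left, Finset.disjoint_union_right]
    exact ⟨⟨disjoint_part p W hik, disjoint_part p W hjk⟩,
      ⟨disjoint_part p W hil, disjoint_part p W hjl⟩⟩
  have hdead := card_insideEdges_add_le (K := fun s => c s ∉ L) (hsub i j) (hsub k l) hdisj
  have hW : W ⊆ (part p W i ∪ part p W j) ∪ (part p W k ∪ part p W l) := by
    intro x hx
    simp only [Finset.mem_union, mem_part]
    have : p x = i ∨ p x = j ∨ p x = k ∨ p x = l := by omega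
    tauto
  have h1 := Finset.card_le_card hW
  rw [Finset.card_union_of_disjoint hdisj] at h1
  have := hu7 0
  unfold deadEdges at *
  exact ⟨e₁, e₂, e₃, e₄, 0, by omega, by omega⟩

theorem IsReducedPartition.card_partNb_eq_two {r : Fin 5 → V} {p : V → Fin 5}
    (h : IsReducedPartition c W 5 p r α β) (hs : StarFree c) (h4 : ∀ i, 4 ≤ (part p W i).card)
    (i : Fin 5) : (partNb c r α i).card = 2 := by
  have := h.card_partNb_le_two hs h4 i
  have := h.swap.card_partNb_le_two hs h4 i
  have := h.card_partNb_add i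
  omega

theorem IsReducedPartition.exists_common_nb {r : Fin 5 → V} {p : V → Fin 5}
    (h : IsReducedPartition c W 5 p r α β) (hs : StarFree c) (h4 : ∀ i, 4 ≤ (part p W i).card)
    {i i' : Fin 5} (hii : i ≠ i') (hα : c s(r i, r i') ≠ α) :
    ∃ j, i ≠ j ∧ i' ≠ j ∧ c s(r j, r i) = α ∧ c s(r j, r i') = α := by
  have h1 := h.card_partNb_eq_two hs h4 i
  have h2 := h.card_partNb_eq_two hs h4 i'
  have hs1 : partNb c r α i ⊆ {i, i'}ᶜ := by
    intro j hj
    rw [mem_partNb] at hj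
    simp only [Finset.mem_compl, Finset.mem_insert, Finset.mem_singleton, not_or]
    exact ⟨hj.1.symm, fun e => hα (e ▸ hj.2)⟩
  have hs2 : partNb c r α i' ⊆ {i, i'}ᶜ := by
    intro j hj
    rw [mem_partNb] at hj
    simp only [Finset.mem_compl, Finset.mem_insert, Finset.mem_singleton, not_or]
    refine ⟨fun e => hα ?_, hj.1.symm⟩
    rw [Sym2.eq_swap]
    exact e ▸ hj.2
  have h3 : ({i, i'}ᶜ : Finset (Fin 5)).card = 3 := by
    rw [Finset.card_compl, Fintype.card_fin, Finset.card_pair hii]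
  obtain ⟨j, hj⟩ := Finset.inter_nonempty_of_card_lt_card_add_card hs1 hs2 (by omega)
  rw [Finset.mem_inter, mem_partNb, mem_partNb] at hj
  refine ⟨j, hj.1.1, hj.2.1, ?_, ?_⟩
  · rw [Sym2.eq_swap]
    exact hj.1.2
  · rw [Sym2.eq_swap]
    exact hj.2.2

theorem IsReducedPartition.exists_two_nb {r : Fin 5 → V} {p : V → Fin 5}
    (h : IsReducedPartition c W 5 p r α β) (hs : StarFree c) (h4 : ∀ i, 4 ≤ (part p W i).card)
    (i j : Fin 5) :
    ∃ k, i ≠ k ∧ j ≠ k ∧ c s(r i, r k) = α := by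
  obtain ⟨k, hk, hkj⟩ := Finset.exists_mem_ne (s := partNb c r α i)
    (by rw [h.card_partNb_eq_two hs h4 i]; omega) j
  rw [mem_partNb] at hk
  exact ⟨k, hk.1, hkj.symm, hk.2⟩

theorem IsReducedPartition.inside_edge_unique {r : Fin 5 → V} {p : V → Fin 5}
    (h : IsReducedPartition c W 5 p r α β) (hs : StarFree c) (h4 : ∀ i, 4 ≤ (part p W i).card)
    {i i' : Fin 5} {a b a' b' : V} (ha : a ∈ part p W i) (hb : b ∈ part p W i)
    (ha' : a' ∈ part p W i') (hb' : b' ∈ part p W i') (hab : a ≠ b) (hab' : a' ≠ b')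
    (hα : c s(a, b) = α) (hα' : c s(a', b') = α) : s(a, b) = s(a', b') := by
  have hne : ∀ {i j : Fin 5} {x y : V}, i ≠ j → x ∈ part p W i → y ∈ part p W j → x ≠ y :=
    fun hij hx hy => (h.color_part hij hx hy).1.symm
  by_cases hii : i = i'
  · subst hii
    obtain ⟨j, hij, hj⟩ := h.exists_left i
    obtain ⟨k, hik, hjk, hk⟩ := h.exists_two_nb hs h4 i j
    have hji : c s(r j, r i) = α := by rwa [Sym2.eq_swap]
    obtain ⟨l, hjl, hil, hl⟩ := h.exists_two_nb hs h4 j i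
    have hi := h.intersecting_two_parts hs h4 hij.symm hjl hil hji hl
    refine mk_eq_of_intersecting (hi.mono Finset.subset_union_left) ?_ ha hb ha' hb' hab hab' hα hα'
    intro a ha b hb b' hb' hab hab' hα hα'
    obtain ⟨x, hx, y, hy, hxy⟩ := Finset.one_lt_card.1 (lt_of_lt_of_le (by omega) (h4 j))
    have hsee : ∀ z ∈ part p W i, ∀ y ∈ part p W j ∪ part p W k, y ≠ z ∧ c s(z, y) = α := by
      intro z hz y hy
      rcases Finset.mem_union.1 hy with hy | hy
      · exact (h.color_part hij hz hy).imp id fun e => e.trans hj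
      · exact (h.color_part hik hz hy).imp id fun e => e.trans hk
    have hout : ∀ z ∈ part p W i, z ∉ part p W j ∪ part p W k := fun z hz hz' =>
      (hsee z hz z hz').1 rfl
    refine hs.eq_of_common_vertex hab hab' hα hα' (hsee a ha) (hout b hb) (hout b' hb') ?_
      (Finset.mem_union_left _ hx) (Finset.mem_union_left _ hy) hxy
      (hsee b hb x (Finset.mem_union_left _ hx)).2 (hsee b' hb' y (Finset.mem_union_left _ hy)).2
    have := h4 j
    have := h4 k
    rw [card_part_union p W hjk]
    omega
  · exfalso
    by_cases hcol : c s(r i, r i') = α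
    · obtain ⟨k, hik, hik', hk⟩ := h.exists_two_nb hs h4 i i'
      have hsee : ∀ z ∈ part p W i, ∀ y ∈ part p W i' ∪ part p W k, y ≠ z ∧ c s(z, y) = α := by
        intro z hz y hy
        rcases Finset.mem_union.1 hy with hy | hy
        · exact (h.color_part hii hz hy).imp id fun e => e.trans hcol
        · exact (h.color_part hik hz hy).imp id fun e => e.trans hk
      have := h4 i'
      have := h4 k
      exact hs.false_of_join hab hab' hα hα' ha' hb'
        (fun y hy => hsee b hb y (Finset.mem_union_left _ hy)) Finset.subset_union_left
        (hsee a ha) (by omega) (by rw [card_part_union p W hik']; omega)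
    · obtain ⟨j, hij, hij', h1, h2⟩ := h.exists_common_nb hs h4 hii hcol
      have hi := h.intersecting_two_parts hs h4 hij.symm hij'.symm hii h1 h2
      have := hi a (Finset.mem_union_left _ ha) b (Finset.mem_union_left _ hb) a'
        (Finset.mem_union_right _ ha') b' (Finset.mem_union_right _ hb') hab hab' hα hα'
      have := hne hii ha ha'
      have := hne hii ha hb'
      have := hne hii hb ha'
      have := hne hii hb hb'
      tauto

theorem IsReducedPartition.sum_card_colorEdges_le_one {r : Fin 5 → V} {p : V → Fin 5}
    (h : IsReducedPartition c W 5 p r α β) (hs : StarFree c) (h4 : ∀ i, 4 ≤ (part p W i).card) :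
    ∑ i, (colorEdges c α (part p W i)).card ≤ 1 := by
  have hK : ∀ i, (colorEdges c α (part p W i)).card ≤ (insideEdges
      (fun s => c s = α ∧ ∀ x ∈ s, ∀ y ∈ s, p x = p y) (part p W i)).card := by
    intro i
    refine Finset.card_le_card fun s => ?_
    induction s with
    | _ a b =>
      rw [mk_mem_colorEdges, mk_mem_insideEdges]
      rintro ⟨ha, hb, hab, hα⟩
      refine ⟨ha, hb, hab, hα, fun x hx y hy => ?_⟩
      rw [mem_part] at ha hb
      rw [Sym2.mem_iff] at hx hy
      rcases hx with rfl | rfl <;> rcases hy with rfl | rfl <;> simp [ha.2, hb.2]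
  refine (Finset.sum_le_sum fun i _ => hK i).trans ?_
  refine (sum_card_insideEdges_le (W := W) Finset.univ (fun i _ => part_subset p W i)
    fun i _ j _ hij => disjoint_part p W hij).trans ?_
  rw [Finset.card_le_one]
  intro s
  induction s with
  | _ a b =>
    intro hs' t
    induction t with
    | _ a' b' =>
      intro ht
      rw [mk_mem_insideEdges] at hs' ht
      have e1 := hs'.2.2.2.2 a (by simp) b (by simp)
      have e2 := ht.2.2.2.2 a' (by simp) b' (by simp)
      exact h.inside_edge_unique hs h4 (mem_part.2 ⟨hs'.1, rfl⟩) (mem_part.2 ⟨hs'.2.1, e1.symm⟩)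
        (mem_part.2 ⟨ht.1, rfl⟩) (mem_part.2 ⟨ht.2.1, e2.symm⟩) hs'.2.2.1 ht.2.2.1 hs'.2.2.2.1
        ht.2.2.2.1

theorem StarFree.card_le_of_five_parts (hs : StarFree c) {L : Finset C} {r : Fin 5 → V}
    {p : V → Fin 5} (h : IsReducedPartition c W 5 p r α β) (h4 : ∀ i, 4 ≤ (part p W i).card)
    {u : ℕ → ℕ} (hb : BoundedBy c ((L.erase α).erase β) u) (hu : DeadUniq c L W) :
    ∃ e₁ e₂ e₃ e₄ e₅, e₁ + e₂ + e₃ + e₄ + e₅ ≤ (deadEdges c L W).card + 2 ∧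
      W.card ≤ u e₁ + u e₂ + u e₃ + u e₄ + u e₅ := by
  have hα := h.sum_card_colorEdges_le_one hs h4
  have hβ := h.swap.sum_card_colorEdges_le_one hs h4
  have hex : ∀ i, ∃ e, e ≤ (deadEdges c L (part p W i)).card + (colorEdges c α (part p W i)).card +
      (colorEdges c β (part p W i)).card ∧ (part p W i).card ≤ u e := by
    intro i
    have h1 := (Finset.single_le_sum (f := fun i => (colorEdges c α (part p W i)).card)
      (fun _ _ => Nat.zero_le _) (Finset.mem_univ i)).trans hα
    have h2 := (Finset.single_le_sum (f := fun i => (colorEdges c β (part p W i)).card)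
      (fun _ _ => Nat.zero_le _) (Finset.mem_univ i)).trans hβ
    obtain ⟨e, he, hle⟩ := hb.exists_le ((hu.mono (part_subset p W i)).erase α h1) h2
    exact ⟨e, he.trans (Nat.add_le_add_right (card_deadEdges_erase_le c L _ α) _), hle⟩
  choose e he hle using hex
  have hdead : ∑ i, (deadEdges c L (part p W i)).card ≤ (deadEdges c L W).card :=
    sum_card_insideEdges_le Finset.univ (fun i _ => part_subset p W i)
      fun i _ j _ hij => disjoint_part p W hij
  have hW : W.card = ∑ i, (part p W i).card :=
    Finset.card_eq_sum_card_fiberwise fun _ _ => Finset.mem_coe.2 (Finset.mem_univ _)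
  have h1 := Finset.sum_le_sum fun i (_ : i ∈ Finset.univ) => he i
  have h2 := Finset.sum_le_sum fun i (_ : i ∈ Finset.univ) => hle i
  simp only [Finset.sum_add_distrib] at h1
  rw [← hW] at h2
  refine ⟨e 0, e 1, e 2, e 3, e 4, ?_, ?_⟩
  · rw [← Fin.sum_univ_five]
    omega
  · rwa [Fin.sum_univ_five] at h2

/-- The recursive bound on the size of a set with live colors `L`. -/
theorem card_le_step (hc : ¬ HasRainbowTriangle c) (hs : StarFree c) {L : Finset C}
    {u₁ u₂ : ℕ → ℕ} (hb₁ : ∀ α ∈ L, BoundedBy c (L.erase α) u₁)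
    (hb₂ : ∀ α ∈ L, ∀ β ∈ L, α ≠ β → BoundedBy c ((L.erase α).erase β) u₂)
    (hu₁ : ∀ e, 7 ≤ u₁ e) (hu₂ : ∀ e, 7 ≤ u₂ e) (hu : DeadUniq c L W) :
    (∃ e₁ e₂, e₁ + e₂ ≤ (deadEdges c L W).card + 1 ∧ W.card ≤ u₁ e₁ + u₁ e₂) ∨
    ∃ e₁ e₂ e₃ e₄ e₅, e₁ + e₂ + e₃ + e₄ + e₅ ≤ (deadEdges c L W).card + 2 ∧
      W.card ≤ u₂ e₁ + u₂ e₂ + u₂ e₃ + u₂ e₄ + u₂ e₅ := by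
  have h70 := hu₁ 0
  by_cases hW : W.card ≤ 2
  · exact Or.inl ⟨0, 0, by omega, by omega⟩
  rcases exists_gallai_partition hc W (by omega) with
    ⟨β, P, Q, hP, hQ, hd, hPQW, hPQ⟩ | ⟨q, hq, p, r, hpr, α, β, hαβ, hor, hex⟩
  · by_cases hβ : β ∈ L
    · exact Or.inl (hs.card_join_le (hb₁ β hβ) hu₁ hu hP hQ hd hPQW hPQ)
    · exfalso
      have hdead : ∀ x ∈ P, ∀ y ∈ Q, s(x, y) ∈ deadEdges c L W := by
        intro x hx y hy
        rw [← hPQW]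
        refine mk_mem_deadEdges.2 ⟨Finset.mem_union_left _ hx, Finset.mem_union_right _ hy,
          fun e => Finset.disjoint_left.1 hd hx (e ▸ hy), by rwa [hPQ x hx y hy]⟩
      have heq : ∀ x ∈ P, ∀ y ∈ Q, ∀ x' ∈ P, ∀ y' ∈ Q, x = x' ∧ y = y' := by
        intro x hx y hy x' hx' y' hy'
        have := hu _ (hdead x hx y hy) _ (hdead x' hx' y' hy')
          ((hPQ x hx y hy).trans (hPQ x' hx' y' hy').symm)
        rcases Sym2.eq_iff.1 this with e | ⟨e, -⟩
        · exact e
        · exact absurd (e ▸ hy') (Finset.disjoint_left.1 hd hx)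
      obtain ⟨x, hx⟩ := hP
      obtain ⟨y, hy⟩ := hQ
      have h1 : P.card ≤ 1 :=
        Finset.card_le_one.2 fun a ha b hb => (heq a ha y hy b hb y hy).1
      have h2 : Q.card ≤ 1 :=
        Finset.card_le_one.2 fun a ha b hb => (heq x hx a ha x hx b hb).2
      have := Finset.card_union_le P Q
      rw [hPQW] at this
      omega
  · right
    have h : IsReducedPartition c W q p r α β :=
      ⟨hpr, hαβ, hor, fun i => (hex i).1, fun i => (hex i).2⟩
    have hb := hb₂ α (h.left_mem hq hu) β (h.swap.left_mem hq hu) hαβ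
    by_cases h4 : ∀ i, 4 ≤ (part p W i).card
    · have hN1 := h.card_partNb_le_two hs h4 ⟨0, by omega⟩
      have hN2 := h.swap.card_partNb_le_two hs h4 ⟨0, by omega⟩
      have hN := h.card_partNb_add ⟨0, by omega⟩
      obtain rfl | rfl | rfl : q = 3 ∨ q = 4 ∨ q = 5 := by omega
      · exfalso
        have key : ∀ i j k : Fin 3, i ≠ j → i ≠ k → j ≠ k → c s(r i, r j) ≠ c s(r i, r k) := by
          intro i j k hij hik hjk e
          have hall : ∀ l, i ≠ l → c s(r i, r l) = c s(r i, r j) := by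
            intro l hl
            have : l = j ∨ l = k := by omega
            rcases this with rfl | rfl
            · rfl
            · exact e.symm
          obtain ⟨l, hl, hlα⟩ := h.exists_left i
          obtain ⟨l', hl', hlβ⟩ := h.exists_right i
          exact hαβ (hlα.symm.trans ((hall l hl).trans ((hall l' hl').symm.trans hlβ)))
        have k0 := key 0 1 2 (by decide) (by decide) (by decide)
        have k1 := key 1 0 2 (by decide) (by decide) (by decide)
        have k2 := key 2 0 1 (by decide) (by decide) (by decide)
        rw [Sym2.eq_swap (a := r 1) (b := r 0)] at k1
        rw [Sym2.eq_swap (a := r 2) (b := r 0), Sym2.eq_swap (a := r 2) (b := r 1)] at k2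
        rcases hor 0 1 (by decide) with a | a <;> rcases hor 0 2 (by decide) with b | b <;>
          rcases hor 1 2 (by decide) with d | d <;> rw [a] at k0 k1 <;> rw [b] at k0 k2 <;>
          rw [d] at k1 k2 <;> tauto
      · exact hs.card_le_of_four_parts h h4 hb hu₂ hu
      · exact hs.card_le_of_five_parts h h4 hb hu
    · push Not at h4
      obtain ⟨i, hi⟩ := h4
      exact hs.card_le_of_small_part h hb hu₂ hu (i := i) (by omega)

end ReducedPartition

section UpperBound

open scoped Classical

variable {V C : Type*} {c : Sym2 V → C}

/-- The largest order of a good coloring with `2 * j + 3` colors. -/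
def criticalOrder : ℕ → ℕ
  | 0 => 35
  | j + 1 => 5 * criticalOrder j + 1

theorem criticalOrder_succ (j : ℕ) : criticalOrder (j + 1) = 5 * criticalOrder j + 1 := rfl

theorem le_criticalOrder (j : ℕ) : 35 * 5 ^ j ≤ criticalOrder j := by
  induction j with
  | zero => simp [criticalOrder]
  | succ j ih =>
    rw [criticalOrder_succ, pow_succ]
    omega

theorem four_mul_criticalOrder (j : ℕ) : 4 * criticalOrder j + 1 = 141 * 5 ^ j := by
  induction j with
  | zero => simp [criticalOrder]
  | succ j ih =>
    rw [criticalOrder_succ, pow_succ]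
    omega

/-- The bound for `2 * j + 3` live colors and `e` dead edges. -/
def oddBound (j e : ℕ) : ℕ := min (criticalOrder j + e / 2) (40 * 5 ^ j)

/-- The bound for `2 * j + 4` live colors and `e` dead edges. -/
def evenBound (j e : ℕ) : ℕ := min (2 * criticalOrder j + e) (85 * 5 ^ j)

theorem boundedBy_oddBound_zero (hc : ¬ HasRainbowTriangle c) (hs : StarFree c) {L : Finset C}
    (hL : L.card = 3) : BoundedBy c L (oddBound 0) := by
  intro W hu
  have key := card_le_step (W := W) hc hs (L := L) (u₁ := twoColorBound) (u₂ := oneColorBound)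
    ?_ ?_ ?_ ?_ hu
  · simp only [twoColorBound, oneColorBound] at key
    simp only [oddBound, criticalOrder]
    rcases key with ⟨e₁, e₂, h, h'⟩ | ⟨e₁, e₂, e₃, e₄, e₅, h, h'⟩
    · omega
    · split_ifs at h' <;> omega
  · intro α hα S hS
    have h2 : (L.erase α).card = 2 := by rw [Finset.card_erase_of_mem hα, hL]
    obtain ⟨x, y, hxy, he⟩ := Finset.card_eq_two.1 h2
    exact card_le_twoColorBound hc hs hxy (by simp [he]) hS
  · intro α hα β hβ hαβ S hS
    have h1 : ((L.erase α).erase β).card = 1 := by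
      rw [Finset.card_erase_of_mem (Finset.mem_erase.2 ⟨hαβ.symm, hβ⟩),
        Finset.card_erase_of_mem hα, hL]
    obtain ⟨x, he⟩ := Finset.card_eq_one.1 h1
    exact card_le_oneColorBound (α := x) hc hs (by simp [he]) hS
  · intro e
    simp only [twoColorBound]
    omega
  · intro e
    simp only [oneColorBound]
    split_ifs <;> omega

theorem boundedBy_evenBound_zero (hc : ¬ HasRainbowTriangle c) (hs : StarFree c) {L : Finset C}
    (hL : L.card = 4) : BoundedBy c L (evenBound 0) := by
  intro W hu
  have key := card_le_step (W := W) hc hs (L := L) (u₁ := oddBound 0) (u₂ := twoColorBound)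
    ?_ ?_ ?_ ?_ hu
  · simp only [twoColorBound, oddBound, criticalOrder] at key
    simp only [evenBound, criticalOrder]
    rcases key with ⟨e₁, e₂, h, h'⟩ | ⟨e₁, e₂, e₃, e₄, e₅, h, h'⟩
    · omega
    · omega
  · intro α hα
    exact boundedBy_oddBound_zero hc hs (by rw [Finset.card_erase_of_mem hα, hL])
  · intro α hα β hβ hαβ S hS
    have h1 : ((L.erase α).erase β).card = 2 := by
      rw [Finset.card_erase_of_mem (Finset.mem_erase.2 ⟨hαβ.symm, hβ⟩),
        Finset.card_erase_of_mem hα, hL]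
    obtain ⟨x, y, hxy, he⟩ := Finset.card_eq_two.1 h1
    exact card_le_twoColorBound hc hs hxy (by simp [he]) hS
  · intro e
    simp only [oddBound, criticalOrder]
    omega
  · intro e
    simp only [twoColorBound]
    omega

theorem boundedBy_oddBound_succ (hc : ¬ HasRainbowTriangle c) (hs : StarFree c) {j : ℕ}
    (hodd : ∀ L : Finset C, L.card = 2 * j + 3 → BoundedBy c L (oddBound j))
    (heven : ∀ L : Finset C, L.card = 2 * j + 4 → BoundedBy c L (evenBound j)) {L : Finset C}
    (hL : L.card = 2 * (j + 1) + 3) : BoundedBy c L (oddBound (j + 1)) := by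
  intro W hu
  have hb := le_criticalOrder j
  have hpos : 1 ≤ 5 ^ j := Nat.one_le_pow _ _ (by norm_num)
  have key := card_le_step (W := W) hc hs (L := L) (u₁ := evenBound j) (u₂ := oddBound j)
    ?_ ?_ ?_ ?_ hu
  · simp only [evenBound, oddBound] at key
    simp only [oddBound, criticalOrder_succ, pow_succ]
    rcases key with ⟨e₁, e₂, h, h'⟩ | ⟨e₁, e₂, e₃, e₄, e₅, h, h'⟩
    · omega
    · omega
  · intro α hα
    exact heven _ (by rw [Finset.card_erase_of_mem hα, hL]; omega)
  · intro α hα β hβ hαβ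
    refine hodd _ ?_
    rw [Finset.card_erase_of_mem (Finset.mem_erase.2 ⟨hαβ.symm, hβ⟩),
      Finset.card_erase_of_mem hα, hL]
    omega
  · intro e
    simp only [evenBound]
    omega
  · intro e
    simp only [oddBound]
    omega

theorem boundedBy_evenBound_succ (hc : ¬ HasRainbowTriangle c) (hs : StarFree c) {j : ℕ}
    (heven : ∀ L : Finset C, L.card = 2 * j + 4 → BoundedBy c L (evenBound j))
    (hodd : ∀ L : Finset C, L.card = 2 * (j + 1) + 3 → BoundedBy c L (oddBound (j + 1)))
    {L : Finset C} (hL : L.card = 2 * (j + 1) + 4) : BoundedBy c L (evenBound (j + 1)) := by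
  intro W hu
  have hb := le_criticalOrder j
  have hpos : 1 ≤ 5 ^ j := Nat.one_le_pow _ _ (by norm_num)
  have key := card_le_step (W := W) hc hs (L := L) (u₁ := oddBound (j + 1)) (u₂ := evenBound j)
    ?_ ?_ ?_ ?_ hu
  · simp only [evenBound, oddBound, criticalOrder_succ, pow_succ] at key
    simp only [evenBound, criticalOrder_succ, pow_succ]
    rcases key with ⟨e₁, e₂, h, h'⟩ | ⟨e₁, e₂, e₃, e₄, e₅, h, h'⟩
    · omega
    · omega
  · intro α hα
    exact hodd _ (by rw [Finset.card_erase_of_mem hα, hL]; omega)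
  · intro α hα β hβ hαβ
    refine heven _ ?_
    rw [Finset.card_erase_of_mem (Finset.mem_erase.2 ⟨hαβ.symm, hβ⟩),
      Finset.card_erase_of_mem hα, hL]
    omega
  · intro e
    simp only [oddBound, criticalOrder_succ, pow_succ]
    omega
  · intro e
    simp only [evenBound]
    omega

theorem boundedBy_oddBound_and_evenBound (hc : ¬ HasRainbowTriangle c) (hs : StarFree c) (j : ℕ) :
    (∀ L : Finset C, L.card = 2 * j + 3 → BoundedBy c L (oddBound j)) ∧
      ∀ L : Finset C, L.card = 2 * j + 4 → BoundedBy c L (evenBound j) := by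
  induction j with
  | zero =>
    exact ⟨fun _ hL => boundedBy_oddBound_zero hc hs hL,
      fun _ hL => boundedBy_evenBound_zero hc hs hL⟩
  | succ j ih =>
    have h : ∀ L : Finset C, L.card = 2 * (j + 1) + 3 → BoundedBy c L (oddBound (j + 1)) :=
      fun _ hL => boundedBy_oddBound_succ hc hs ih.1 ih.2 hL
    exact ⟨h, fun _ hL => boundedBy_evenBound_succ hc hs ih.2 h hL⟩

theorem card_le_of_boundedBy_univ [Fintype V] [Fintype C] {u : ℕ → ℕ}
    (h : BoundedBy c Finset.univ u) : Fintype.card V ≤ u 0 := by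
  have hd : deadEdges c Finset.univ (Finset.univ : Finset V) = ∅ := by
    rw [Finset.eq_empty_iff_forall_notMem]
    intro s
    induction s with
    | _ x y => exact fun hs => (mk_mem_deadEdges.1 hs).2.2.2 (Finset.mem_univ _)
  have := h Finset.univ (fun s hs => by simp [hd] at hs)
  rwa [hd, Finset.card_empty, Finset.card_univ] at this

end UpperBound

section LowerBound

open scoped Classical

/-- A coloring (given off the diagonal by a symmetric function) with colors in `L ∪ D` without
rainbow triangles, without monochromatic `S_8^2` in a color of `L`, in which every color of `D`
occurs on at most one edge. -/
structure IsGoodColoring {V C : Type*} (f : V → V → C) (L D : Finset C) : Prop where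
  symm : ∀ x y, f x y = f y x
  mem : ∀ x y, x ≠ y → f x y ∈ L ∨ f x y ∈ D
  triangle : ∀ x y z, x ≠ y → y ≠ z → x ≠ z → f x y = f y z ∨ f y z = f x z ∨ f x y = f x z
  star : ∀ α ∈ L, ∀ g : Fin 8 → V, Function.Injective g → (∀ i, i ≠ 0 → f (g 0) (g i) = α) →
    f (g 1) (g 2) = α → f (g 3) (g 4) ≠ α
  uniq : ∀ α ∈ D, ∀ x y x' y', x ≠ y → x' ≠ y' → f x y = α → f x' y' = α →
    x = x' ∧ y = y' ∨ x = y' ∧ y = x'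

/-- There is a good coloring on `n` vertices. -/
def ExistsGoodColoring {C : Type*} (L D : Finset C) (n : ℕ) : Prop :=
  ∃ (V : Type) (_ : Fintype V) (f : V → V → C), IsGoodColoring f L D ∧ Fintype.card V = n

variable {C : Type*}

/-- The substitution of the colorings `f i` into the coloring `ρ`. -/
noncomputable def substColoring {ι : Type*} {V : ι → Type*} (ρ : ι → ι → C)
    (f : ∀ i, V i → V i → C) (x y : Σ i, V i) : C :=
  if h : x.1 = y.1 then f y.1 (h ▸ x.2) y.2 else ρ x.1 y.1

theorem substColoring_same {ι : Type*} {V : ι → Type*} (ρ : ι → ι → C)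
    (f : ∀ i, V i → V i → C) (i : ι) (x y : V i) :
    substColoring ρ f ⟨i, x⟩ ⟨i, y⟩ = f i x y := by
  simp [substColoring]

theorem substColoring_of_ne {ι : Type*} {V : ι → Type*} (ρ : ι → ι → C)
    (f : ∀ i, V i → V i → C) {x y : Σ i, V i} (h : x.1 ≠ y.1) :
    substColoring ρ f x y = ρ x.1 y.1 := by
  simp [substColoring, h]

theorem substColoring_mk_of_ne {ι : Type*} {V : ι → Type*} (ρ : ι → ι → C)
    (f : ∀ i, V i → V i → C) {i j : ι} (h : i ≠ j) (x : V i) (y : V j) :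
    substColoring ρ f ⟨i, x⟩ ⟨j, y⟩ = ρ i j :=
  substColoring_of_ne ρ f h

/-- Substituting good colorings into a coloring without monochromatic triangles. -/
theorem IsGoodColoring.subst {ι : Type*} {V : ι → Type*} {ρ : ι → ι → C}
    {f : ∀ i, V i → V i → C} {L M D : Finset C} {E : ι → Finset C}
    (hf : ∀ i, IsGoodColoring (f i) L (E i)) (hρ : ∀ i j, ρ i j = ρ j i)
    (hM : ∀ i j, i ≠ j → ρ i j ∈ M)
    (hrain : ∀ i j k, i ≠ j → j ≠ k → i ≠ k → ρ i j = ρ j k ∨ ρ j k = ρ i k ∨ ρ i j = ρ i k)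
    (hmono : ∀ i j k, i ≠ j → j ≠ k → i ≠ k → ρ i j = ρ i k → ρ j k ≠ ρ i j)
    (hE : ∀ i, E i ⊆ M ∪ D) (hdisj : ∀ i j α, α ∈ E i → α ∈ E j → i = j)
    (hLM : Disjoint L M) (hLD : Disjoint L D) (hMD : Disjoint M D) :
    IsGoodColoring (substColoring ρ f) (L ∪ M) D := by
  have hinside : ∀ α ∉ L, ∀ x y x' y' : Σ i, V i, x ≠ y → x' ≠ y' → x.1 = y.1 → x'.1 = y'.1 →
      substColoring ρ f x y = α → substColoring ρ f x' y' = α →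
      x = x' ∧ y = y' ∨ x = y' ∧ y = x' := by
    rintro α hα ⟨i, x⟩ ⟨j, y⟩ ⟨i', x'⟩ ⟨j', y'⟩ hxy hxy' h h' hc hc'
    obtain rfl : i = j := h
    obtain rfl : i' = j' := h'
    rw [substColoring_same] at hc hc'
    have hxy : x ≠ y := fun e => hxy (by rw [e])
    have hxy' : x' ≠ y' := fun e => hxy' (by rw [e])
    have h1 : α ∈ E i := by
      rcases (hf i).mem x y hxy with h | h <;> rw [hc] at h
      exacts [absurd h hα, h]
    have h2 : α ∈ E i' := by
      rcases (hf i').mem x' y' hxy' with h | h <;> rw [hc'] at h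
      exacts [absurd h hα, h]
    obtain rfl := hdisj _ _ _ h1 h2
    rcases (hf i).uniq α h1 x y x' y' hxy hxy' hc hc' with ⟨rfl, rfl⟩ | ⟨rfl, rfl⟩ <;> simp
  refine ⟨?_, ?_, ?_, ?_, ?_⟩
  · rintro ⟨i, x⟩ ⟨j, y⟩
    by_cases h : i = j
    · subst h
      rw [substColoring_same, substColoring_same, (hf i).symm]
    · rw [substColoring_of_ne ρ f h, substColoring_of_ne ρ f (Ne.symm h), hρ]
  · rintro ⟨i, x⟩ ⟨j, y⟩ hxy
    by_cases h : i = j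
    · subst h
      rw [substColoring_same]
      rcases (hf i).mem x y fun e => hxy (by rw [e]) with h | h
      · exact Or.inl (Finset.mem_union_left _ h)
      · rcases Finset.mem_union.1 (hE i h) with h | h
        · exact Or.inl (Finset.mem_union_right _ h)
        · exact Or.inr h
    · rw [substColoring_of_ne ρ f h]
      exact Or.inl (Finset.mem_union_right _ (hM _ _ h))
  · rintro ⟨i, x⟩ ⟨j, y⟩ ⟨k, z⟩ hxy hyz hxz
    by_cases hij : i = j
    · subst hij
      by_cases hik : i = k
      · subst hik
        simp only [substColoring_same]
        exact (hf i).triangle x y z (fun e => hxy (by rw [e])) (fun e => hyz (by rw [e]))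
          fun e => hxz (by rw [e])
      · exact Or.inr (Or.inl (by rw [substColoring_mk_of_ne ρ f hik, substColoring_mk_of_ne ρ f hik]))
    · by_cases hik : i = k
      · subst hik
        exact Or.inl (by
          rw [substColoring_mk_of_ne ρ f hij, substColoring_mk_of_ne ρ f (Ne.symm hij), hρ])
      · by_cases hjk : j = k
        · subst hjk
          exact Or.inr (Or.inr (by rw [substColoring_mk_of_ne ρ f hij, substColoring_mk_of_ne ρ f hik]))
        · rw [substColoring_mk_of_ne ρ f hij, substColoring_mk_of_ne ρ f hik,
            substColoring_mk_of_ne ρ f hjk]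
          exact hrain i j k hij hjk hik
  · intro α hα g hg h0 h12 h34
    rcases Finset.mem_union.1 hα with hα | hα
    · obtain ⟨i₀, hsame⟩ : ∃ i₀, ∀ i, ∃ y, g i = ⟨i₀, y⟩ := by
        refine ⟨(g 0).1, fun i => ?_⟩
        by_cases h : (g i).1 = (g 0).1
        · exact ⟨h ▸ (g i).2, by rw [Sigma.ext_iff]; simp [h]⟩
        · have hi : i ≠ 0 := fun e => h (by rw [e])
          have := h0 i hi
          rw [substColoring_of_ne ρ f (Ne.symm h)] at this
          exact absurd (this ▸ hM _ _ (Ne.symm h)) (Finset.disjoint_left.1 hLM hα)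
      choose g' hg' using hsame
      refine (hf i₀).star α hα g' ?_ ?_ ?_ ?_
      · intro i j hij
        exact hg (by rw [hg' i, hg' j, hij])
      · intro i hi
        have := h0 i hi
        rwa [hg' i, hg' 0, substColoring_same] at this
      · rwa [hg' 1, hg' 2, substColoring_same] at h12
      · rwa [hg' 3, hg' 4, substColoring_same] at h34
    · have hαL : α ∉ L := fun h => Finset.disjoint_left.1 hLM h hα
      have hne : ∀ i j : Fin 8, i ≠ j → g i ≠ g j := fun i j hij e => hij (hg e)
      have htri : ∀ i j : Fin 8, i ≠ 0 → j ≠ 0 → i ≠ j → substColoring ρ f (g i) (g j) = α →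
          (g 0).1 = (g i).1 ∨ (g 0).1 = (g j).1 ∨ (g i).1 = (g j).1 := by
        intro i j hi hj hij hc
        by_contra! hn
        have e1 := h0 i hi
        have e2 := h0 j hj
        rw [substColoring_of_ne ρ f hn.1] at e1
        rw [substColoring_of_ne ρ f hn.2.1] at e2
        rw [substColoring_of_ne ρ f hn.2.2] at hc
        exact hmono _ _ _ hn.1 hn.2.2 hn.2.1 (e1.trans e2.symm) (hc.trans e1.symm)
      have hedge : ∀ i j : Fin 8, i ≠ 0 → j ≠ 0 → i ≠ j → substColoring ρ f (g i) (g j) = α →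
          ∃ a b, (a = 0 ∧ b = i ∨ a = 0 ∧ b = j ∨ a = i ∧ b = j) ∧ a ≠ b ∧ (g a).1 = (g b).1 ∧
            substColoring ρ f (g a) (g b) = α := by
        intro i j hi hj hij hc
        rcases htri i j hi hj hij hc with h | h | h
        · exact ⟨0, i, by simp, hi.symm, h, h0 i hi⟩
        · exact ⟨0, j, by simp, hj.symm, h, h0 j hj⟩
        · exact ⟨i, j, by simp, hij, h, hc⟩
      obtain ⟨a, b, hab, hne1, hs1, hc1⟩ := hedge 1 2 (by decide) (by decide) (by decide) h12
      obtain ⟨a', b', hab', hne2, hs2, hc2⟩ := hedge 3 4 (by decide) (by decide) (by decide) h34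
      have := hinside α hαL _ _ _ _ (hne _ _ hne1) (hne _ _ hne2) hs1 hs2 hc1 hc2
      simp only [hg.eq_iff] at this
      omega
  · intro α hα x y x' y' hxy hxy' h h'
    have hαL : α ∉ L := fun h => Finset.disjoint_left.1 hLD h hα
    have hin : ∀ x y : Σ i, V i, substColoring ρ f x y = α → x.1 = y.1 := by
      intro x y h
      by_contra hn
      rw [substColoring_of_ne ρ f hn] at h
      exact Finset.disjoint_left.1 hMD (h ▸ hM _ _ hn) hα
    exact hinside α hαL x y x' y' hxy hxy' (hin _ _ h) (hin _ _ h') h h'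

theorem existsGoodColoring_subst {ι : Type} [Fintype ι] {ρ : ι → ι → C} {n : ι → ℕ}
    {L M D : Finset C} {E : ι → Finset C}
    (hf : ∀ i, ExistsGoodColoring L (E i) (n i)) (hρ : ∀ i j, ρ i j = ρ j i)
    (hM : ∀ i j, i ≠ j → ρ i j ∈ M)
    (hrain : ∀ i j k, i ≠ j → j ≠ k → i ≠ k → ρ i j = ρ j k ∨ ρ j k = ρ i k ∨ ρ i j = ρ i k)
    (hmono : ∀ i j k, i ≠ j → j ≠ k → i ≠ k → ρ i j = ρ i k → ρ j k ≠ ρ i j)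
    (hE : ∀ i, E i ⊆ M ∪ D) (hdisj : ∀ i j α, α ∈ E i → α ∈ E j → i = j)
    (hLM : Disjoint L M) (hLD : Disjoint L D) (hMD : Disjoint M D) :
    ExistsGoodColoring (L ∪ M) D (∑ i, n i) := by
  choose V hV f hgood hcard using hf
  exact ⟨Σ i, V i, inferInstance, substColoring ρ f,
    IsGoodColoring.subst hgood hρ hM hrain hmono hE hdisj hLM hLD hMD, by simp [hcard]⟩

/-- Adjacency in the five-cycle. -/
def fiveCycle (i j : Fin 5) : Bool := j = i + 1 || i = j + 1

theorem fiveCycle_comm : ∀ i j, fiveCycle i j = fiveCycle j i := by decide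

theorem fiveCycle_no_triangle : ∀ i j k, i ≠ j → j ≠ k → i ≠ k →
    fiveCycle i j = fiveCycle i k → fiveCycle j k ≠ fiveCycle i j := by decide

theorem existsGoodColoring_pentagon {a b : C} (hab : a ≠ b) {L D D₀ D₁ : Finset C} {n n₀ n₁ : ℕ}
    (h₀ : ExistsGoodColoring L D₀ n₀) (h₁ : ExistsGoodColoring L D₁ n₁)
    (h : ExistsGoodColoring L ∅ n) (hd : Disjoint D₀ D₁) (hD₀ : D₀ ⊆ {a, b} ∪ D)
    (hD₁ : D₁ ⊆ {a, b} ∪ D) (hLM : Disjoint L {a, b}) (hLD : Disjoint L D)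
    (hMD : Disjoint {a, b} D) : ExistsGoodColoring (L ∪ {a, b}) D (n₀ + n₁ + 3 * n) := by
  have key := existsGoodColoring_subst (ι := Fin 5)
    (ρ := fun i j => if fiveCycle i j then a else b) (n := ![n₀, n₁, n, n, n])
    (L := L) (M := {a, b}) (D := D) (E := ![D₀, D₁, ∅, ∅, ∅]) ?_ ?_ ?_ ?_ ?_ ?_ ?_ hLM hLD hMD
  · convert key using 1
    simp [Fin.sum_univ_five]
    ring
  · intro i
    fin_cases i
    exacts [h₀, h₁, h, h, h]
  · intro i j
    simp only [fiveCycle_comm i j]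
  · intro i j _
    split_ifs <;> simp
  · intro i j k _ _ _
    split_ifs <;> simp
  · intro i j k hij hjk hik
    have := fiveCycle_no_triangle i j k hij hjk hik
    have hinj : ∀ x y : Bool, (if x then a else b) = (if y then a else b) ↔ x = y := by
      intro x y
      cases x <;> cases y <;> simp [hab, hab.symm]
    simpa only [hinj, ne_eq] using this
  · intro i
    fin_cases i
    exacts [hD₀, hD₁, Finset.empty_subset _, Finset.empty_subset _, Finset.empty_subset _]
  · intro i j α hi hj
    have : α ∈ D₀ → α ∉ D₁ := fun h => Finset.disjoint_left.1 hd h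
    fin_cases i <;> fin_cases j <;> simp_all

theorem existsGoodColoring_double {a : C} {L : Finset C} {n : ℕ}
    (h : ExistsGoodColoring L ∅ n) (ha : a ∉ L) : ExistsGoodColoring (L ∪ {a}) ∅ (2 * n) := by
  have key := existsGoodColoring_subst (ι := Fin 2) (ρ := fun _ _ => a) (n := fun _ => n)
    (L := L) (M := {a}) (D := ∅) (E := fun _ => ∅) (fun _ => h) (by simp) (by simp) (by simp)
    ?_ (by simp) (by simp) (by simpa using ha) (by simp) (by simp)
  · simpa using key
  · intro i j k hij hjk hik
    omega

theorem existsGoodColoring_seven (a : C) : ExistsGoodColoring {a} ∅ 7 := by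
  refine ⟨Fin 7, inferInstance, fun _ _ => a, ⟨by simp, by simp, by simp, ?_, by simp⟩, by simp⟩
  intro α _ g hg
  have := Fintype.card_le_of_injective g hg
  simp at this

theorem existsGoodColoring_eight {a : C} {D : Finset C} (hD : D.card = 4) (ha : a ∉ D) :
    ExistsGoodColoring {a} D 8 := by
  obtain ⟨e⟩ : Nonempty (Fin 4 ≃ D) := ⟨Fintype.equivOfCardEq (by simp [hD])⟩
  refine ⟨Fin 4 × Bool, inferInstance, fun x y => if x.1 = y.1 then (e x.1 : C) else a,
    ⟨?_, ?_, ?_, ?_, ?_⟩, by simp⟩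
  · intro x y
    by_cases h : x.1 = y.1
    · simp [h]
    · simp [h, Ne.symm h]
  · intro x y _
    split_ifs
    · exact Or.inr (e x.1).2
    · exact Or.inl (Finset.mem_singleton_self a)
  · rintro ⟨i, x⟩ ⟨j, y⟩ ⟨k, z⟩ hxy hyz hxz
    dsimp only
    by_cases hij : i = j <;> by_cases hjk : j = k <;> by_cases hik : i = k <;> simp_all
  · intro α hα g hg h0
    exfalso
    obtain rfl := Finset.mem_singleton.1 hα
    obtain ⟨i, hi⟩ := ((Fintype.bijective_iff_injective_and_card g).2 ⟨hg, by simp⟩).2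
      ((g 0).1, !(g 0).2)
    have hi0 : i ≠ 0 := by
      rintro rfl
      have := congrArg Prod.snd hi
      simp at this
    have := h0 i hi0
    rw [hi] at this
    simp only [if_true] at this
    exact ha (this ▸ (e (g 0).1).2)
  · rintro α hα ⟨i, x⟩ ⟨j, y⟩ ⟨i', x'⟩ ⟨j', y'⟩ hxy hxy' h h'
    dsimp only at h h'
    split_ifs at h with h1
    · split_ifs at h' with h2
      · obtain rfl : i = j := h1
        obtain rfl : i' = j' := h2
        obtain rfl : i = i' := e.injective (Subtype.ext (h.trans h'.symm))
        cases x <;> cases y <;> cases x' <;> cases y' <;> simp_all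
      · exact absurd (h' ▸ hα) ha
    · exact absurd (h ▸ hα) ha

theorem exists_eq_union_pair {L : Finset C} {n : ℕ} (hL : L.card = n + 2) :
    ∃ (L' : Finset C) (a b : C), a ≠ b ∧ L'.card = n ∧ Disjoint L' {a, b} ∧ L = L' ∪ {a, b} := by
  obtain ⟨M, hM, hMc⟩ := Finset.exists_subset_card_eq (s := L) (n := 2) (by omega)
  obtain ⟨a, b, hab, rfl⟩ := Finset.card_eq_two.1 hMc
  refine ⟨L \ {a, b}, a, b, hab, ?_, Finset.sdiff_disjoint, (Finset.sdiff_union_of_subset hM).symm⟩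
  rw [Finset.card_sdiff_of_subset hM, hMc, hL]
  omega

theorem existsGoodColoring_odd (j : ℕ) : ∀ L : Finset C, L.card = 2 * j + 3 →
    ExistsGoodColoring L ∅ (criticalOrder j) ∧ ∀ D : Finset C, Disjoint L D → D.card = 2 →
      ExistsGoodColoring L D (criticalOrder j + 1) := by
  induction j with
  | zero =>
    intro L hL
    obtain ⟨L', a, b, hab, hc, hd, rfl⟩ := exists_eq_union_pair (n := 1) hL
    obtain ⟨x, rfl⟩ := Finset.card_eq_one.1 hc
    have h7 := existsGoodColoring_seven x
    refine ⟨existsGoodColoring_pentagon hab h7 h7 h7 (by simp) (by simp) (by simp) hd (by simp)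
      (by simp), fun D hLD hD => ?_⟩
    rw [Finset.disjoint_union_left] at hLD
    have h8 := existsGoodColoring_eight (a := x) (D := {a, b} ∪ D)
      (by rw [Finset.card_union_of_disjoint hLD.2, hD, Finset.card_pair hab])
      (by
        rw [← Finset.disjoint_singleton_left, Finset.disjoint_union_right]
        exact ⟨hd, hLD.1⟩)
    exact existsGoodColoring_pentagon hab h8 h7 h7 (by simp) (by simp) (by simp) hd hLD.1 hLD.2
  | succ j ih =>
    intro L hL
    obtain ⟨L', a, b, hab, hc, hd, rfl⟩ := exists_eq_union_pair (n := 2 * j + 3) hL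
    obtain ⟨h, hD'⟩ := ih L' hc
    have h0 := hD' {a, b} hd (Finset.card_pair hab)
    constructor
    · have := existsGoodColoring_pentagon hab h0 h h (D := ∅) (by simp) (by simp) (by simp) hd
        (by simp) (by simp)
      convert this using 1
      rw [criticalOrder_succ]
      ring
    · intro D hLD hD
      rw [Finset.disjoint_union_left] at hLD
      have := existsGoodColoring_pentagon hab h0 (hD' D hLD.1 hD) h (D := D) hLD.2
        Finset.subset_union_left Finset.subset_union_right hd hLD.1 hLD.2
      convert this using 1
      rw [criticalOrder_succ]
      ring

theorem existsGoodColoring_even (j : ℕ) {L : Finset C} (hL : L.card = 2 * j + 4) :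
    ExistsGoodColoring L ∅ (2 * criticalOrder j) := by
  obtain ⟨a, ha⟩ : L.Nonempty := Finset.card_pos.1 (by omega)
  have h := existsGoodColoring_double (a := a) (existsGoodColoring_odd j (L.erase a)
    (by rw [Finset.card_erase_of_mem ha, hL]; omega)).1 (Finset.notMem_erase a L)
  rwa [Finset.union_comm, ← Finset.insert_eq, Finset.insert_erase ha] at h

theorem sGraph_adj_zero {i : Fin 8} (hi : i ≠ 0) : (SGraph 8 2).Adj 0 i := by
  simp [SGraph, SimpleGraph.fromRel_adj, hi.symm]

theorem ExistsGoodColoring.exists_coloring [Fintype C] {n m : ℕ}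
    (h : ExistsGoodColoring (Finset.univ : Finset C) ∅ m) (hn : n ≤ m) :
    ∃ c : Sym2 (Fin n) → C, ¬ HasRainbowTriangle c ∧ ¬ HasMonoCopy (SGraph 8 2) c := by
  obtain ⟨V, _, f, hf, rfl⟩ := h
  obtain ⟨e⟩ : Nonempty (Fin n ↪ V) := Function.Embedding.nonempty_of_card_le (by simpa using hn)
  refine ⟨Sym2.lift ⟨fun x y => f (e x) (e y), fun x y => hf.symm _ _⟩, ?_, ?_⟩
  · rintro ⟨x, y, z, h1, h2, h3⟩
    simp only [Sym2.lift_mk] at h1 h2 h3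
    have hxy : x ≠ y := fun h => h2 (by rw [h])
    have hyz : y ≠ z := fun h => h3 (by rw [h])
    have hxz : x ≠ z := fun h => h1 (by rw [h, hf.symm])
    have := hf.triangle (e x) (e y) (e z) (e.injective.ne hxy) (e.injective.ne hyz)
      (e.injective.ne hxz)
    tauto
  · rintro ⟨g, α, hg⟩
    refine hf.star α (Finset.mem_univ _) (fun i => e (g i)) (e.injective.comp g.injective)
      (fun i hi => hg 0 i (sGraph_adj_zero hi)) (hg 1 2 ?_) (hg 3 4 ?_) <;>
    simp [SGraph, SimpleGraph.fromRel_adj]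

end LowerBound

theorem isLeast_gallaiRamsey {k N : ℕ}
    (hub : ∀ n : ℕ, ∀ c : Sym2 (Fin n) → Fin k, ¬ HasRainbowTriangle c →
      ¬ HasMonoCopy (SGraph 8 2) c → n ≤ N)
    (hlb : ExistsGoodColoring (Finset.univ : Finset (Fin k)) ∅ N) :
    IsLeast {n : ℕ | ∀ c : Sym2 (Fin n) → Fin k,
      HasRainbowTriangle c ∨ HasMonoCopy (SGraph 8 2) c} (N + 1) := by
  constructor
  · intro c
    by_contra! h
    have := hub _ c h.1 h.2
    omega
  · intro n hn
    by_contra! hlt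
    obtain ⟨c, h1, h2⟩ := hlb.exists_coloring (n := n) (by omega)
    exact (hn c).elim h1 h2

theorem isLeast_gallaiRamsey_odd (j : ℕ) :
    IsLeast {n : ℕ | ∀ c : Sym2 (Fin n) → Fin (2 * j + 3),
      HasRainbowTriangle c ∨ HasMonoCopy (SGraph 8 2) c} (criticalOrder j + 1) := by
  refine isLeast_gallaiRamsey (fun n c h1 h2 => ?_) (existsGoodColoring_odd j _ (by simp)).1
  have := card_le_of_boundedBy_univ
    ((boundedBy_oddBound_and_evenBound h1 (starFree_of_not_hasMonoCopy h2) j).1 _ (by simp))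
  rw [Fintype.card_fin] at this
  exact this.trans (min_le_left _ _)

theorem isLeast_gallaiRamsey_even (j : ℕ) :
    IsLeast {n : ℕ | ∀ c : Sym2 (Fin n) → Fin (2 * j + 4),
      HasRainbowTriangle c ∨ HasMonoCopy (SGraph 8 2) c} (2 * criticalOrder j + 1) := by
  refine isLeast_gallaiRamsey (fun n c h1 h2 => ?_) (existsGoodColoring_even j (by simp))
  have := card_le_of_boundedBy_univ
    ((boundedBy_oddBound_and_evenBound h1 (starFree_of_not_hasMonoCopy h2) j).2 _ (by simp))
  rw [Fintype.card_fin] at this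
  exact this.trans (min_le_left _ _)

theorem gallai_ramsey_S82 (k : ℕ) (hk : 3 ≤ k) :
    ∃ N : ℕ,
      IsLeast {n : ℕ | ∀ c : Sym2 (Fin n) → Fin k,
        HasRainbowTriangle c ∨ HasMonoCopy (SGraph 8 2) c} N ∧
      (Even k → (N : ℚ) = 14 * 5 ^ ((k - 2) / 2) + (1 / 2) * 5 ^ ((k - 4) / 2) + 1 / 2) ∧
      (Odd k → (N : ℚ) = 7 * 5 ^ ((k - 1) / 2) + (1 / 4) * 5 ^ ((k - 3) / 2) + 3 / 4) := by
  rcases Nat.even_or_odd k with h | h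
  · obtain ⟨j, rfl⟩ : ∃ j, k = 2 * j + 4 := by
      obtain ⟨m, rfl⟩ := h
      exact ⟨m - 2, by omega⟩
    refine ⟨_, isLeast_gallaiRamsey_even j, fun _ => ?_, fun h' => ?_⟩
    · have hb : (4 * criticalOrder j + 1 : ℚ) = 141 * 5 ^ j := mod_cast four_mul_criticalOrder j
      rw [show (2 * j + 4 - 2) / 2 = j + 1 by omega, show (2 * j + 4 - 4) / 2 = j by omega,
        pow_succ]
      push_cast
      linarith
    · exact absurd h (Nat.not_even_iff_odd.2 h')
  · obtain ⟨j, rfl⟩ : ∃ j, k = 2 * j + 3 := by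
      obtain ⟨m, rfl⟩ := h
      exact ⟨m - 1, by omega⟩
    refine ⟨_, isLeast_gallaiRamsey_odd j, fun h' => ?_, fun _ => ?_⟩
    · exact absurd h (Nat.not_odd_iff_even.2 h')
    · have hb : (4 * criticalOrder j + 1 : ℚ) = 141 * 5 ^ j := mod_cast four_mul_criticalOrder j
      rw [show (2 * j + 3 - 1) / 2 = j + 1 by omega, show (2 * j + 3 - 3) / 2 = j by omega,
        pow_succ]
      push_cast
      linarith
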